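/- arXiv:2403.05708 — 2 statements merged into one kernel-verified Lean document; each statement's English description precedes it below -/
import Mathlib

section
/- Let τ > 0, α ∈ ℂ, m ≤ q and n ≤ p nonnegative integers, a ∈ ℂ^p, b ∈ ℂ^q with λ♯ < λ♭, and suppose that either N > 0, or N = 0 and Re(α) > 0. Then for every c ∈ (λ♯, λ♭) ∩ ℝ and every w ∈ ℂ the integral defining K^{m,n}_{p,q}(a;b | e^{2πw}; τ, α) converges absolutely, its value does not depend on the choice of c, and the function w ↦ K^{m,n}_{p,q}(a;b | e^{2πw}; τ, α) is an entire function of w. -/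
open Complex Filter MeasureTheory Set

noncomputable section

/-- The digamma function ψ = Γ'/Γ. -/
def digammaC (z : ℂ) : ℂ := deriv Complex.Gamma z / Complex.Gamma z

/-- The gamma modular form C(τ). -/
def gammaModC (τ : ℂ) : ℂ :=
  limUnder atTop fun M : ℕ =>
    (∑ k ∈ Finset.Ico 1 M, digammaC (k * τ)) + digammaC (M * τ) / 2
      - (1 / τ) * Complex.log (Complex.Gamma (M * τ) / (Real.sqrt (2 * Real.pi) : ℂ))

/-- The gamma modular form D(τ). -/
def gammaModD (τ : ℂ) : ℂ :=
  limUnder atTop fun M : ℕ =>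
    (∑ k ∈ Finset.Ico 1 M, deriv digammaC (k * τ)) + deriv digammaC (M * τ) / 2
      - (1 / τ) * digammaC (M * τ)

def aBarnes (τ : ℂ) : ℂ :=
  -(Real.eulerMascheroniConstant : ℂ) * τ + (τ / 2) * Complex.log (2 * Real.pi * τ)
    + (1 / 2) * Complex.log τ - τ * gammaModC τ

def bBarnes (τ : ℂ) : ℂ :=
  -(Real.pi : ℂ) ^ 2 * τ ^ 2 / 6 - τ * Complex.log τ - τ ^ 2 * gammaModD τ

/-- The Barnes double gamma function `G(z;τ)`, via its Weierstrass product. -/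
def barnesG (z τ : ℂ) : ℂ :=
  z / τ * Complex.exp (aBarnes τ * z / τ + bBarnes τ * z ^ 2 / (2 * τ)) *
    ∏' mn : ℕ × ℕ,
      if mn = (0, 0) then 1
      else (1 + z / (mn.1 * τ + mn.2)) *
        Complex.exp (-(z / (mn.1 * τ + mn.2)) + z ^ 2 / (2 * ((mn.1 : ℂ) * τ + (mn.2 : ℂ)) ^ 2))

/-- The ratio of Barnes double gamma functions `𝒢^{m,n}_{p,q}(a;b | s;τ)`. -/
def calG (m n : ℕ) {p q : ℕ} (a : Fin p → ℂ) (b : Fin q → ℂ) (s τ : ℂ) : ℂ :=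
  ((∏ j : Fin q, if (j : ℕ) < m then barnesG (b j - s) τ else 1) *
      ∏ j : Fin p, if (j : ℕ) < n then barnesG (1 + τ - a j + s) τ else 1) /
    ((∏ j : Fin q, if m ≤ (j : ℕ) then barnesG (1 + τ - b j + s) τ else 1) *
      ∏ j : Fin p, if n ≤ (j : ℕ) then barnesG (a j - s) τ else 1)

/-- `N = 2(m+n) - p - q`. -/
def paramN (m n p q : ℕ) : ℤ := 2 * (m + n) - p - q

/-- `ν = Σ a_j - Σ b_j`. -/
def paramNu {p q : ℕ} (a : Fin p → ℂ) (b : Fin q → ℂ) : ℂ := (∑ j, a j) - ∑ j, b j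

/-- `μ = Σ_{j≤n} a_j - Σ_{j>n} a_j + Σ_{j≤m} b_j - Σ_{j>m} b_j`. -/
def paramMu (m n : ℕ) {p q : ℕ} (a : Fin p → ℂ) (b : Fin q → ℂ) : ℂ :=
  (∑ j : Fin p, if (j : ℕ) < n then a j else 0) - (∑ j : Fin p, if n ≤ (j : ℕ) then a j else 0)
    + (∑ j : Fin q, if (j : ℕ) < m then b j else 0) - ∑ j : Fin q, if m ≤ (j : ℕ) then b j else 0

/-- `ξ = Σ_{j≤n} a_j² - Σ_{j>n} a_j² + Σ_{j≤m} b_j² - Σ_{j>m} b_j²`. -/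
def paramXi (m n : ℕ) {p q : ℕ} (a : Fin p → ℂ) (b : Fin q → ℂ) : ℂ :=
  (∑ j : Fin p, if (j : ℕ) < n then a j ^ 2 else 0)
    - (∑ j : Fin p, if n ≤ (j : ℕ) then a j ^ 2 else 0)
    + (∑ j : Fin q, if (j : ℕ) < m then b j ^ 2 else 0)
    - ∑ j : Fin q, if m ≤ (j : ℕ) then b j ^ 2 else 0

/-- The Meijer–Barnes `K`-function with vertical contour `c + iℝ`, at `z = e^{2πw}`:
`K^{m,n}_{p,q}(a;b | e^{2πw}; τ, α) = (1/(2πi)) ∫_{c+iℝ} 𝒢(s) e^{(πα/τ)s²} e^{-2πws} ds`. -/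
def Kfun (m n : ℕ) {p q : ℕ} (a : Fin p → ℂ) (b : Fin q → ℂ) (τ α : ℂ) (c : ℝ) (w : ℂ) : ℂ :=
  1 / (2 * Real.pi * Complex.I) *
    ∫ t : ℝ, (calG m n a b (c + t * Complex.I) τ *
      Complex.exp ((Real.pi : ℂ) * α / τ * (c + t * Complex.I) ^ 2) *
      Complex.exp (-(2 * Real.pi * w * (c + t * Complex.I)))) * Complex.I

/-- The genus-two Weierstrass elementary factor `(1 + v) exp(-v + v²/2)`. -/
def elemFactor (v : ℂ) : ℂ := (1 + v) * Complex.exp (-v + v ^ 2 / 2)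

lemma hasDerivAt_elemFactor (v : ℂ) :
    HasDerivAt elemFactor (v ^ 2 * Complex.exp (-v + v ^ 2 / 2)) v := by
  have h1 : HasDerivAt (fun v : ℂ => -v + v ^ 2 / 2) (-1 + v) v := by
    refine ((hasDerivAt_id' v).neg.add ((hasDerivAt_pow 2 v).div_const 2)).congr_deriv ?_
    push_cast
    ring
  refine (((hasDerivAt_id' v).const_add 1).mul h1.cexp).congr_deriv ?_
  ring

lemma differentiable_elemFactor : Differentiable ℂ elemFactor :=
  fun v => (hasDerivAt_elemFactor v).differentiableAt

lemma norm_elemFactor_sub_one_le {v : ℂ} {M : ℝ} (hv : ‖v‖ ≤ M) :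
    ‖elemFactor v - 1‖ ≤ Real.exp (M + M ^ 2 / 2) * ‖v‖ ^ 3 := by
  have hM : 0 ≤ M := (norm_nonneg v).trans hv
  have key := Convex.norm_image_sub_le_of_norm_hasDerivWithin_le (𝕜 := ℂ)
    (f := elemFactor) (f' := fun v => v ^ 2 * Complex.exp (-v + v ^ 2 / 2))
    (s := Metric.closedBall 0 ‖v‖) (x := 0) (y := v)
    (C := ‖v‖ ^ 2 * Real.exp (M + M ^ 2 / 2))
    (fun x _ => (hasDerivAt_elemFactor x).hasDerivWithinAt)
    (fun x hx => by
      have hx' : ‖x‖ ≤ ‖v‖ := by simpa using hx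
      have hxM := hx'.trans hv
      rw [norm_mul, norm_pow]
      refine mul_le_mul (by gcongr) ((Complex.norm_exp_le_exp_norm _).trans ?_)
        (norm_nonneg _) (by positivity)
      refine Real.exp_le_exp.2 ((norm_add_le _ _).trans ?_)
      rw [norm_neg, norm_div, norm_pow, Complex.norm_ofNat]
      gcongr)
    (convex_closedBall _ _) (by simp) (by simp)
  have h0 : elemFactor 0 = 1 := by simp [elemFactor]
  rw [h0, sub_zero] at key
  calc _ ≤ _ := key
    _ = _ := by ring

lemma norm_elemFactor_conj (v : ℂ) : ‖elemFactor (starRingEnd ℂ v)‖ = ‖elemFactor v‖ := by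
  have : elemFactor (starRingEnd ℂ v) = starRingEnd ℂ (elemFactor v) := by
    simp only [elemFactor, map_mul, map_add, map_one, ← Complex.exp_conj, map_neg, map_div₀,
      map_pow, map_ofNat]
  rw [this, Complex.norm_conj]

/-- Comparison of the elementary factor at two points of the half-plane `Re v ≥ -1/2`. -/
lemma norm_elemFactor_le_of_re_ge {v v' : ℂ} {M : ℝ} (hv : -(1 / 2) ≤ v.re)
    (hv' : -(1 / 2) ≤ v'.re) (hvM : ‖v‖ ≤ M) (hvM' : ‖v'‖ ≤ M) :
    ‖elemFactor v‖ ≤ ‖elemFactor v'‖ * Real.exp (3 * M ^ (3 / 2 : ℝ) * ‖v - v'‖) := by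
  set L : ℂ → ℂ := fun v => Complex.log (1 + v) + (-v + v ^ 2 / 2) with hL
  have hslit : ∀ x : ℂ, -(1 / 2) ≤ x.re → 1 + x ∈ Complex.slitPlane := fun x hx =>
    Or.inl (by simp only [Complex.add_re, Complex.one_re]; linarith)
  have hexp : ∀ x : ℂ, -(1 / 2) ≤ x.re → ‖elemFactor x‖ = Real.exp (L x).re := fun x hx => by
    rw [← Complex.norm_exp, hL, Complex.exp_add, Complex.exp_log
      (Complex.slitPlane_ne_zero (hslit x hx)), elemFactor]
  have hconv : Convex ℝ ({x : ℂ | -(1 / 2) ≤ x.re} ∩ Metric.closedBall 0 M) :=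
    (convex_halfSpace_re_ge _).inter (convex_closedBall _ _)
  have key := Convex.norm_image_sub_le_of_norm_hasDerivWithin_le (𝕜 := ℂ)
    (f := L) (f' := fun x => x ^ 2 / (1 + x))
    (s := {x : ℂ | -(1 / 2) ≤ x.re} ∩ Metric.closedBall 0 M) (x := v') (y := v)
    (C := 3 * M ^ (3 / 2 : ℝ))
    (fun x hx => by
      have hne := Complex.slitPlane_ne_zero (hslit x hx.1)
      have h1 := ((hasDerivAt_id' x).const_add 1).clog (hslit x hx.1)
      have h2 := (hasDerivAt_id' x).neg.add ((hasDerivAt_pow 2 x).div_const 2)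
      refine ((h1.add h2).congr_deriv ?_).hasDerivWithinAt
      field_simp
      push_cast
      ring)
    (fun x hx => by
      have hxM : ‖x‖ ≤ M := by simpa using hx.2
      have h1 : (1 / 2 : ℝ) ≤ ‖1 + x‖ := by
        refine le_trans ?_ (Complex.re_le_norm _)
        have : -(1 / 2) ≤ x.re := hx.1
        simp only [Complex.add_re, Complex.one_re]
        linarith
      have h2 : ‖x‖ ≤ ‖1 + x‖ + 1 := by
        calc ‖x‖ = ‖(1 + x) - 1‖ := by ring_nf
          _ ≤ _ := (norm_sub_le _ _).trans (by simp)
      have h3 : √‖x‖ ≤ 3 * ‖1 + x‖ := by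
        rw [Real.sqrt_le_left (by positivity)]
        nlinarith
      rw [norm_div, norm_pow, div_le_iff₀ (by linarith)]
      have h4 : ‖x‖ ^ 2 = ‖x‖ ^ (3 / 2 : ℝ) * √‖x‖ := by
        rw [Real.sqrt_eq_rpow, ← Real.rpow_add' (norm_nonneg _) (by norm_num),
          ← Real.rpow_natCast]
        norm_num
      rw [h4]
      have hM0 : 0 ≤ M := (norm_nonneg _).trans hxM
      calc ‖x‖ ^ (3 / 2 : ℝ) * √‖x‖ ≤ M ^ (3 / 2 : ℝ) * (3 * ‖1 + x‖) := by gcongr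
        _ = _ := by ring)
    hconv ⟨hv', by simpa using hvM'⟩ ⟨hv, by simpa using hvM⟩
  rw [hexp v hv, hexp v' hv', ← Real.exp_add, Real.exp_le_exp]
  have := (Complex.re_le_norm _).trans key
  rw [Complex.sub_re] at this
  linarith

/-- Comparison of the elementary factor at `z x` and `z' x`, for a point `z` with
`Re z ≥ -R` and a point `z'` in the closed right half-plane. -/
lemma norm_elemFactor_mul_le {z z' : ℂ} {R M x : ℝ} (hR : 0 ≤ R) (hx : 0 ≤ x) (hz : -R ≤ z.re)
    (hz' : 0 ≤ z'.re) (hM : ‖z‖ + 2 * R ≤ M) (hM' : ‖z'‖ ≤ M) :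
    ‖elemFactor (z * x)‖ ≤ ‖elemFactor (z' * x)‖ *
      Real.exp ((3 * M ^ (3 / 2 : ℝ) * (‖z - z'‖ + 2 * R) + (2 * R) ^ (5 / 2 : ℝ)) *
        x ^ (5 / 2 : ℝ)) := by
  have hM0 : 0 ≤ M := (norm_nonneg _).trans hM'
  have hnx : ‖(x : ℂ)‖ = x := by simp [abs_of_nonneg hx]
  have hpow : ∀ d : ℝ, 3 * (M * x) ^ (3 / 2 : ℝ) * (d * x)
      = 3 * M ^ (3 / 2 : ℝ) * d * x ^ (5 / 2 : ℝ) := fun d => by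
    have : x ^ (5 / 2 : ℝ) = x ^ (3 / 2 : ℝ) * x := by
      conv_rhs => rw [← Real.rpow_add_one' hx (by norm_num)]
      norm_num
    rw [Real.mul_rpow hM0 hx, this]
    ring
  have compare : ∀ ζ : ℂ, -(1 / 2) ≤ ζ.re * x → ‖ζ‖ ≤ M →
      ‖elemFactor (ζ * x)‖ ≤ ‖elemFactor (z' * x)‖ *
        Real.exp (3 * M ^ (3 / 2 : ℝ) * ‖ζ - z'‖ * x ^ (5 / 2 : ℝ)) := fun ζ hζ hζM => by
    have h := norm_elemFactor_le_of_re_ge (v := ζ * x) (v' := z' * x) (M := M * x)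
      (by rwa [Complex.re_mul_ofReal])
      (by rw [Complex.re_mul_ofReal]; nlinarith [mul_nonneg hz' hx])
      (by rw [norm_mul, hnx]; gcongr) (by rw [norm_mul, hnx]; gcongr)
    rwa [← sub_mul, norm_mul, hnx, hpow] at h
  have hxp : 0 ≤ x ^ (5 / 2 : ℝ) := by positivity
  have hMp : 0 ≤ M ^ (3 / 2 : ℝ) := by positivity
  have hRp : 0 ≤ (2 * R) ^ (5 / 2 : ℝ) := by positivity
  rcases le_or_gt (2 * R * x) 1 with hle | hgt
  · refine (compare z (by nlinarith) (by linarith)).trans ?_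
    gcongr
    nlinarith [mul_nonneg hMp hR]
  · have h1 : ‖elemFactor (z * x)‖ ≤
        ‖elemFactor ((z + 2 * R) * x)‖ * Real.exp (2 * R * x) := by
      have hre : -(R * x) ≤ (z * x).re := by
        rw [Complex.re_mul_ofReal]; nlinarith
      have hnorm : ‖1 + z * x‖ ≤ ‖1 + (z + 2 * R) * x‖ := by
        have e : (1 + (z + 2 * R) * x : ℂ) = ((1 + (z * x).re + 2 * R * x : ℝ) : ℂ)
            + (z * x).im * Complex.I := by
          conv_lhs => rw [add_mul, ← Complex.re_add_im (z * x)]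
          push_cast
          ring
        have e' : (1 + z * x : ℂ) = ((1 + (z * x).re : ℝ) : ℂ) + (z * x).im * Complex.I := by
          conv_lhs => rw [← Complex.re_add_im (z * x)]
          push_cast
          ring
        rw [e, e', Complex.norm_add_mul_I, Complex.norm_add_mul_I]
        apply Real.sqrt_le_sqrt
        have : 0 ≤ R * x := by positivity
        nlinarith
      have hexp : (-(z * x) + (z * x) ^ 2 / 2 : ℂ).re ≤
          (-((z + 2 * R) * x) + ((z + 2 * R) * x) ^ 2 / 2 : ℂ).re + 2 * R * x := by
        have e : (-((z + 2 * R) * x) + ((z + 2 * R) * x) ^ 2 / 2 : ℂ)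
            = (-(z * x) + (z * x) ^ 2 / 2) + ((2 * R * x : ℝ) : ℂ) * (z * x)
              + ((- (2 * R * x) + 2 * (R * x) ^ 2 : ℝ) : ℂ) := by
          push_cast
          ring
        generalize hQ : (-(z * x) + (z * x) ^ 2 / 2 : ℂ) = Q at e ⊢
        rw [e, Complex.add_re, Complex.add_re, Complex.re_ofReal_mul, Complex.ofReal_re]
        have : 0 ≤ R * x := by positivity
        nlinarith
      rw [elemFactor, elemFactor, norm_mul, norm_mul, Complex.norm_exp, Complex.norm_exp,
        mul_assoc, ← Real.exp_add]
      gcongr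
    have h2 := compare (z + 2 * R) (by
        have : (z + 2 * R : ℂ).re = z.re + 2 * R := by simp
        rw [this]; nlinarith)
      ((norm_add_le _ _).trans (by simpa [abs_of_nonneg hR] using hM))
    have h3 : 2 * R * x ≤ (2 * R) ^ (5 / 2 : ℝ) * x ^ (5 / 2 : ℝ) := by
      rw [← Real.mul_rpow (by positivity) hx]
      exact Real.self_le_rpow_of_one_le hgt.le (by norm_num)
    have h4 : ‖z + 2 * R - z'‖ ≤ ‖z - z'‖ + 2 * R := by
      calc ‖z + 2 * R - z'‖ = ‖(z - z') + 2 * R‖ := by ring_nf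
        _ ≤ _ := (norm_add_le _ _).trans (by simp [abs_of_nonneg hR])
    calc _ ≤ _ := h1
      _ ≤ _ := mul_le_mul_of_nonneg_right h2 (Real.exp_nonneg _)
      _ ≤ _ := by
        rw [mul_assoc, ← Real.exp_add]
        gcongr
        nlinarith [mul_le_mul_of_nonneg_left h4 (mul_nonneg hMp hxp)]

/-- The canonical product of genus two with zeros at the points `-1 / x i`. -/
def canonProd {ι : Type*} (x : ι → ℝ) (z : ℂ) : ℂ := ∏' i, elemFactor (z * x i)

section canonProd

variable {ι : Type*} {x : ι → ℝ} {U : ℝ}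

lemma canonProd_local_bound (hx : ∀ i, 0 ≤ x i) (hU : ∀ i, x i ≤ U) (R : ℝ) (i : ι) {z : ℂ}
    (hz : ‖z‖ ≤ R) : ‖elemFactor (z * x i) - 1‖ ≤
      Real.exp (R * U + (R * U) ^ 2 / 2) * R ^ 3 * x i ^ 3 := by
  have hR : 0 ≤ R := (norm_nonneg _).trans hz
  have hn : ‖z * x i‖ = ‖z‖ * x i := by simp [abs_of_nonneg (hx i)]
  have h := norm_elemFactor_sub_one_le (v := z * x i) (M := R * U)
    (by rw [hn]; exact mul_le_mul hz (hU i) (hx i) hR)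
  refine h.trans ?_
  rw [mul_assoc, ← mul_pow, hn]
  have := hx i
  gcongr

lemma hasProdLocallyUniformlyOn_canonProd (hx : ∀ i, 0 ≤ x i) (hU : ∀ i, x i ≤ U)
    (h3 : Summable fun i => x i ^ 3) (R : ℝ) :
    HasProdLocallyUniformlyOn (fun i z => elemFactor (z * x i)) (canonProd x)
      (Metric.ball 0 R) := by
  have h := Summable.hasProdLocallyUniformlyOn_one_add (f := fun i z => elemFactor (z * x i) - 1)
    (K := Metric.ball (0 : ℂ) R) Metric.isOpen_ball
    (h3.mul_left (Real.exp (R * U + (R * U) ^ 2 / 2) * R ^ 3))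
    (Eventually.of_forall fun i z hz => canonProd_local_bound hx hU R i (mem_ball_zero_iff.1 hz).le)
    (fun i => ((differentiable_elemFactor.continuous.comp (by fun_prop)).sub
      continuous_const).continuousOn)
  simp only [add_sub_cancel] at h
  exact h

lemma hasProd_canonProd (hx : ∀ i, 0 ≤ x i) (hU : ∀ i, x i ≤ U)
    (h3 : Summable fun i => x i ^ 3) (z : ℂ) :
    HasProd (fun i => elemFactor (z * x i)) (canonProd x z) :=
  (hasProdLocallyUniformlyOn_canonProd hx hU h3 (‖z‖ + 1)).hasProd (by simp)

lemma differentiable_canonProd (hx : ∀ i, 0 ≤ x i) (hU : ∀ i, x i ≤ U)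
    (h3 : Summable fun i => x i ^ 3) : Differentiable ℂ (canonProd x) := fun z => by
  have h := (hasProdLocallyUniformlyOn_canonProd hx hU h3 (‖z‖ + 1))
  have hd : DifferentiableOn ℂ (canonProd x) (Metric.ball 0 (‖z‖ + 1)) := by
    refine TendstoLocallyUniformlyOn.differentiableOn h (Eventually.of_forall fun s => ?_)
      Metric.isOpen_ball
    refine Differentiable.differentiableOn ?_
    exact Differentiable.fun_finsetProd fun i _ => differentiable_elemFactor.comp (by fun_prop)
  exact hd.differentiableAt (Metric.isOpen_ball.mem_nhds (by simp))

lemma norm_canonProd_conj (hx : ∀ i, 0 ≤ x i) (hU : ∀ i, x i ≤ U)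
    (h3 : Summable fun i => x i ^ 3) (z : ℂ) :
    ‖canonProd x (starRingEnd ℂ z)‖ = ‖canonProd x z‖ := by
  refine (hasProd_canonProd hx hU h3 _).norm.unique ?_
  convert (hasProd_canonProd hx hU h3 z).norm using 2 with i
  rw [← norm_elemFactor_conj, map_mul, Complex.conj_conj, Complex.conj_ofReal]

lemma norm_canonProd_le (hx : ∀ i, 0 ≤ x i) (hU : ∀ i, x i ≤ U)
    (h3 : Summable fun i => x i ^ 3) (h52 : Summable fun i => x i ^ (5 / 2 : ℝ))
    {z z' : ℂ} {R M : ℝ} (hR : 0 ≤ R) (hz : -R ≤ z.re)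
    (hz' : 0 ≤ z'.re) (hM : ‖z‖ + 2 * R ≤ M) (hM' : ‖z'‖ ≤ M) :
    ‖canonProd x z‖ ≤ ‖canonProd x z'‖ *
      Real.exp ((3 * M ^ (3 / 2 : ℝ) * (‖z - z'‖ + 2 * R) + (2 * R) ^ (5 / 2 : ℝ)) *
        ∑' i, x i ^ (5 / 2 : ℝ)) := by
  have hM0 : 0 ≤ M := (norm_nonneg _).trans hM'
  refine le_of_tendsto_of_tendsto' (hasProd_canonProd hx hU h3 z).norm
    ((hasProd_canonProd hx hU h3 z').norm.mul_const _) fun s => ?_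
  calc ∏ i ∈ s, ‖elemFactor (z * x i)‖ ≤ ∏ i ∈ s, (‖elemFactor (z' * x i)‖ *
      Real.exp ((3 * M ^ (3 / 2 : ℝ) * (‖z - z'‖ + 2 * R) + (2 * R) ^ (5 / 2 : ℝ)) *
        x i ^ (5 / 2 : ℝ))) := Finset.prod_le_prod (fun _ _ => norm_nonneg _)
          fun i _ => norm_elemFactor_mul_le hR (hx i) hz hz' hM hM'
    _ ≤ _ := by
      rw [Finset.prod_mul_distrib, ← Real.exp_sum, ← Finset.mul_sum]
      have hs := h52.sum_le_tsum s fun i _ => Real.rpow_nonneg (hx i) _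
      have : 0 ≤ ∏ i ∈ s, ‖elemFactor (z' * x i)‖ :=
        Finset.prod_nonneg fun _ _ => norm_nonneg _
      gcongr

lemma canonProd_ne_zero (hx : ∀ i, 0 ≤ x i) (hU : ∀ i, x i ≤ U)
    (h3 : Summable fun i => x i ^ 3) (h52 : Summable fun i => x i ^ (5 / 2 : ℝ))
    {z : ℂ} (hz : 0 ≤ z.re) : canonProd x z ≠ 0 := fun h0 => by
  have h := norm_canonProd_le hx hU h3 h52 (z := 0) (z' := z) (R := 0) (M := ‖z‖) le_rfl
    (by simp) hz (by simp) le_rfl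
  rw [h0] at h
  simp [canonProd, elemFactor] at h
  norm_num at h

lemma norm_elemFactor_mul_I (t y : ℝ) :
    ‖elemFactor (t * Complex.I * y)‖ = √(1 + (t * y) ^ 2) * Real.exp (-((t * y) ^ 2 / 2)) := by
  have e1 : (1 + t * Complex.I * y : ℂ) = ((1 : ℝ) : ℂ) + ((t * y : ℝ) : ℂ) * Complex.I := by
    push_cast; ring
  have e2 : (-(t * Complex.I * y) + (t * Complex.I * y) ^ 2 / 2 : ℂ)
      = ((-((t * y) ^ 2 / 2) : ℝ) : ℂ) + ((-(t * y) : ℝ) : ℂ) * Complex.I := by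
    have : (t * Complex.I * y : ℂ) ^ 2 = t ^ 2 * y ^ 2 * Complex.I ^ 2 := by ring
    rw [this, Complex.I_sq]
    push_cast
    ring
  rw [elemFactor, norm_mul, e1, Complex.norm_add_mul_I, Complex.norm_exp, e2,
    Complex.add_re, Complex.ofReal_re, Complex.re_ofReal_mul, Complex.I_re, mul_zero, add_zero,
    one_pow]

lemma norm_elemFactor_mul_I_le_one (t y : ℝ) : ‖elemFactor (t * Complex.I * y)‖ ≤ 1 := by
  rw [norm_elemFactor_mul_I]
  have h : √(1 + (t * y) ^ 2) ≤ Real.exp ((t * y) ^ 2 / 2) := by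
    rw [Real.sqrt_le_left (Real.exp_nonneg _), ← Real.exp_nat_mul]
    refine (add_comm _ _).trans_le ((Real.add_one_le_exp _).trans_eq ?_)
    congr 1
    push_cast
    ring
  calc _ ≤ Real.exp ((t * y) ^ 2 / 2) * Real.exp (-((t * y) ^ 2 / 2)) := by gcongr
    _ = 1 := by rw [← Real.exp_add]; simp

lemma norm_elemFactor_mul_I_le {t y : ℝ} (h : 4 ≤ (t * y) ^ 2) :
    ‖elemFactor (t * Complex.I * y)‖ ≤ Real.exp (-((t * y) ^ 2 / 4)) := by
  rw [norm_elemFactor_mul_I]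
  have h : √(1 + (t * y) ^ 2) ≤ Real.exp ((t * y) ^ 2 / 4) := by
    rw [Real.sqrt_le_left (Real.exp_nonneg _), ← Real.exp_nat_mul]
    have := Real.quadratic_le_exp_of_nonneg (x := (t * y) ^ 2 / 2) (by positivity)
    have e : ((2 : ℕ) : ℝ) * ((t * y) ^ 2 / 4) = (t * y) ^ 2 / 2 := by push_cast; ring
    rw [e]
    nlinarith
  calc _ ≤ Real.exp ((t * y) ^ 2 / 4) * Real.exp (-((t * y) ^ 2 / 2)) := by gcongr
    _ = _ := by rw [← Real.exp_add]; congr 1; ring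

/-- If the squares `x i ^ 2` are not summable, the canonical product decays on the imaginary axis
faster than every Gaussian. -/
lemma norm_canonProd_mul_I_le (hx : ∀ i, 0 ≤ x i) (hU : ∀ i, x i ≤ U)
    (h3 : Summable fun i => x i ^ 3) (h2 : ¬ Summable fun i => x i ^ 2) {M : ℝ} (hM : 0 ≤ M) :
    ∃ C : ℝ, 0 < C ∧ ∀ t : ℝ, ‖canonProd x (t * Complex.I)‖ ≤ C * Real.exp (-(M * t ^ 2)) := by
  obtain ⟨s, hs⟩ : ∃ s : Finset ι, 4 * M < ∑ i ∈ s, x i ^ 2 := by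
    by_contra! hcon
    exact h2 (summable_of_sum_le (fun i => sq_nonneg _) hcon)
  have hsmall : ∀ t : ℝ, ∀ s : Finset ι, ‖canonProd x (t * Complex.I)‖ ≤
      ∏ i ∈ s, ‖elemFactor (t * Complex.I * x i)‖ := fun t s => by
    refine le_of_tendsto (hasProd_canonProd hx hU h3 _).norm ?_
    filter_upwards [eventually_ge_atTop s] with s' hs'
    exact Finset.prod_le_prod_of_subset_of_le_one hs' (fun _ _ => norm_nonneg _)
      fun i _ _ => norm_elemFactor_mul_I_le_one t (x i)
  obtain ⟨T, hT⟩ : ∃ T : ℝ, ∀ t : ℝ, T ≤ t ^ 2 → ∀ i ∈ s,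
      ‖elemFactor (t * Complex.I * x i)‖ ≤ Real.exp (-((t * x i) ^ 2 / 4)) := by
    have : ∀ᶠ T : ℝ in atTop, ∀ i ∈ s, 4 ≤ T * x i ^ 2 ∨ x i = 0 := by
      rw [Filter.eventually_all_finset]
      intro i _
      rcases (hx i).eq_or_lt with h0 | h0
      · exact Eventually.of_forall fun _ => Or.inr h0.symm
      · filter_upwards [eventually_ge_atTop (4 / x i ^ 2)] with T hT
        left
        rwa [div_le_iff₀ (by positivity)] at hT
    obtain ⟨T, hT⟩ := this.exists
    refine ⟨T, fun t ht i hi => ?_⟩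
    rcases hT i hi with h | h
    · refine norm_elemFactor_mul_I_le ?_
      rw [mul_pow]
      exact h.trans (by gcongr)
    · simp [h, elemFactor]
  refine ⟨Real.exp (M * max T 0), Real.exp_pos _, fun t => ?_⟩
  rw [← Real.exp_add]
  rcases le_or_gt T (t ^ 2) with h | h
  · refine (hsmall t s).trans ((Finset.prod_le_prod (fun _ _ => norm_nonneg _) (hT t h)).trans ?_)
    rw [← Real.exp_sum, Real.exp_le_exp]
    have e : ∑ i ∈ s, -((t * x i) ^ 2 / 4) = -(t ^ 2 * (∑ i ∈ s, x i ^ 2) / 4) := by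
      rw [Finset.sum_neg_distrib, ← Finset.sum_div, Finset.mul_sum]
      simp only [mul_pow]
    rw [e]
    have h1 : 0 ≤ M * max T 0 := mul_nonneg hM (le_max_right _ _)
    nlinarith [sq_nonneg t]
  · refine (hsmall t ∅).trans ?_
    rw [Finset.prod_empty]
    refine Real.one_le_exp ?_
    have : t ^ 2 ≤ max T 0 := h.le.trans (le_max_left _ _)
    nlinarith

end canonProd

/-- The inverses `1 / (mτ + n)` of the lattice points, with value `0` at the origin. -/
def invLattice (τ : ℝ) (mn : ℕ × ℕ) : ℝ := (mn.1 * τ + mn.2)⁻¹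

section invLattice

variable {τ : ℝ}

lemma invLattice_nonneg (hτ : 0 < τ) (mn : ℕ × ℕ) : 0 ≤ invLattice τ mn := by
  unfold invLattice
  positivity

lemma invLattice_sq_le (hτ : 0 < τ) (mn : ℕ × ℕ) :
    invLattice τ mn ^ 2 * ((mn.1 + 1) * (mn.2 + 1)) ≤ (3 / (2 * min τ 1)) ^ 2 := by
  obtain ⟨k, l⟩ := mn
  have hc : 0 < min τ 1 := lt_min hτ one_pos
  rcases eq_or_ne (k + l) 0 with h | h
  · obtain ⟨rfl, rfl⟩ : k = 0 ∧ l = 0 := by omega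
    simp [invLattice]
    positivity
  · have h1 : (1 : ℝ) ≤ k + l := by exact_mod_cast Nat.one_le_iff_ne_zero.2 h
    have h2 : min τ 1 * (k + l) ≤ k * τ + l := by
      have := mul_le_mul_of_nonneg_left (min_le_left τ 1) (Nat.cast_nonneg (α := ℝ) k)
      have := mul_le_mul_of_nonneg_left (min_le_right τ 1) (Nat.cast_nonneg (α := ℝ) l)
      linarith
    have h3 : 0 < min τ 1 * (k + l : ℝ) := by positivity
    have h4 : ((k : ℝ) + 1) * (l + 1) ≤ (3 / 2 * (k + l)) ^ 2 := by
      nlinarith [sq_nonneg ((k : ℝ) - l)]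
    calc invLattice τ (k, l) ^ 2 * (((k : ℕ) + 1 : ℝ) * ((l : ℕ) + 1))
        ≤ (min τ 1 * (k + l))⁻¹ ^ 2 * (3 / 2 * (k + l)) ^ 2 := by
          unfold invLattice
          gcongr
      _ = _ := by
          field_simp

lemma invLattice_le (hτ : 0 < τ) (mn : ℕ × ℕ) : invLattice τ mn ≤ 3 / (2 * min τ 1) := by
  have hc : 0 < min τ 1 := lt_min hτ one_pos
  refine le_of_sq_le_sq ?_ (by positivity)
  refine le_trans ?_ (invLattice_sq_le hτ mn)
  refine le_mul_of_one_le_right (sq_nonneg _) ?_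
  have h1 : (0 : ℝ) ≤ mn.1 := Nat.cast_nonneg _
  have h2 : (0 : ℝ) ≤ mn.2 := Nat.cast_nonneg _
  nlinarith

lemma summable_invLattice_rpow (hτ : 0 < τ) {k : ℝ} (hk : 2 < k) :
    Summable fun mn => invLattice τ mn ^ k := by
  have hc : 0 < min τ 1 := lt_min hτ one_pos
  have hs : Summable fun n : ℕ => ((n : ℝ) + 1) ^ (-(k / 2)) := by
    have := (summable_nat_add_iff 1).2 (Real.summable_nat_rpow (p := -(k / 2)) |>.2 (by linarith))
    simpa using this
  have hs2 := (hs.mul_of_nonneg hs (fun n => by positivity) (fun n => by positivity)).mul_left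
    (((3 / (2 * min τ 1)) ^ 2) ^ (k / 2))
  refine Summable.of_nonneg_of_le (fun mn => Real.rpow_nonneg (invLattice_nonneg hτ mn) _)
    (fun mn => ?_) hs2
  have h0 := invLattice_nonneg hτ mn
  have hpos : (0 : ℝ) < (mn.1 + 1) * (mn.2 + 1) := by positivity
  have h := Real.rpow_le_rpow (by positivity) (invLattice_sq_le hτ mn)
    (by linarith : 0 ≤ k / 2)
  rw [Real.mul_rpow (by positivity) hpos.le, ← Real.rpow_natCast (invLattice τ mn),
    ← Real.rpow_mul h0] at h
  have e : ((2 : ℕ) : ℝ) * (k / 2) = k := by push_cast; ring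
  rw [e] at h
  rw [← Real.mul_rpow (by positivity) (by positivity), Real.rpow_neg hpos.le, ← div_eq_mul_inv,
    le_div_iff₀ (by positivity)]
  exact h

lemma summable_invLattice_pow_three (hτ : 0 < τ) : Summable fun mn => invLattice τ mn ^ 3 := by
  have := summable_invLattice_rpow hτ (k := 3) (by norm_num)
  exact_mod_cast this

lemma not_summable_invLattice_sq (hτ : 0 < τ) : ¬ Summable fun mn => invLattice τ mn ^ 2 := by
  intro h
  obtain ⟨h1, h2⟩ := (summable_prod_of_nonneg fun _ => sq_nonneg _).1 h
  have h3 : Summable fun k : ℕ => 1 / (τ + 1) ^ 2 * (1 / (k : ℝ)) := by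
    refine Summable.of_nonneg_of_le (fun k => by positivity) (fun k => ?_) h2
    refine le_trans ?_ ((h1 k).sum_le_tsum (Finset.range k) fun _ _ => sq_nonneg _)
    rcases k.eq_zero_or_pos with rfl | hk
    · simp
    have hk' : (0 : ℝ) < k := by exact_mod_cast hk
    calc 1 / (τ + 1) ^ 2 * (1 / (k : ℝ)) = ∑ l ∈ Finset.range k, ((k * τ + k : ℝ)⁻¹) ^ 2 := by
          rw [Finset.sum_const, Finset.card_range, nsmul_eq_mul]
          field_simp
      _ ≤ _ := Finset.sum_le_sum fun l hl => by
          have : (l : ℝ) ≤ k := by exact_mod_cast (Finset.mem_range.1 hl).le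
          unfold invLattice
          gcongr
  rw [summable_mul_left_iff (by positivity)] at h3
  exact Real.not_summable_one_div_natCast h3

end invLattice

lemma barnesG_eq_canonProd (τ : ℝ) (z : ℂ) :
    barnesG z τ = z / τ * Complex.exp (aBarnes τ * z / τ + bBarnes τ * z ^ 2 / (2 * τ)) *
      canonProd (invLattice τ) z := by
  unfold barnesG canonProd
  congr 1
  refine tprod_congr fun mn => ?_
  split_ifs with h
  · simp [h, invLattice, elemFactor]
  · simp only [elemFactor, invLattice]
    push_cast
    simp only [div_eq_mul_inv, mul_inv, mul_pow, inv_pow]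
    ring_nf

lemma differentiable_barnesG {τ : ℝ} (hτ : 0 < τ) : Differentiable ℂ fun z => barnesG z τ := by
  simp only [barnesG_eq_canonProd]
  have h : Differentiable ℂ (canonProd (invLattice τ)) :=
    differentiable_canonProd (invLattice_nonneg hτ) (invLattice_le hτ)
      (summable_invLattice_pow_three hτ)
  fun_prop

lemma barnesG_ne_zero {τ : ℝ} (hτ : 0 < τ) {z : ℂ} (hz : 0 < z.re) : barnesG z τ ≠ 0 := by
  rw [barnesG_eq_canonProd]
  have h0 : z ≠ 0 := by rintro rfl; simp at hz
  refine mul_ne_zero (mul_ne_zero (div_ne_zero h0 (by exact_mod_cast hτ.ne'))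
    (Complex.exp_ne_zero _)) ?_
  exact canonProd_ne_zero (invLattice_nonneg hτ) (invLattice_le hτ)
    (summable_invLattice_pow_three hτ) (summable_invLattice_rpow hτ (by norm_num)) hz.le

/-- The common size, up to a factor `exp (O(|t| ^ (3 / 2)))`, of `G(z;τ)` on vertical lines. -/
def vertSize (τ t : ℝ) : ℝ :=
  Real.exp (-((bBarnes τ / (2 * τ)).re * t ^ 2)) * ‖canonProd (invLattice τ) (t * Complex.I)‖

/-- The scale of the error terms on vertical lines. -/
def vertError (t : ℝ) : ℝ := (1 + |t|) ^ (3 / 2 : ℝ)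

lemma one_add_abs_le_vertError (t : ℝ) : 1 + |t| ≤ vertError t :=
  Real.self_le_rpow_of_one_le (by linarith [abs_nonneg t]) (by norm_num)

lemma one_le_vertError (t : ℝ) : 1 ≤ vertError t :=
  le_trans (by linarith [abs_nonneg t]) (one_add_abs_le_vertError t)

lemma vertError_neg (t : ℝ) : vertError (-t) = vertError t := by simp [vertError]

lemma exists_mul_vertError_le (K : ℝ) {ε : ℝ} (hε : 0 < ε) :
    ∃ C : ℝ, ∀ t : ℝ, K * vertError t ≤ ε * t ^ 2 + C := by
  set η : ℝ := ε / (4 * (|K| + 1)) with hη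
  have hη0 : 0 < η := by positivity
  refine ⟨ε + |K| * (1 / (64 * η ^ 3)), fun t => ?_⟩
  have hy : 0 ≤ 1 + |t| := by positivity
  have e : vertError t = (1 + |t|) * √(1 + |t|) := by
    rw [vertError, Real.sqrt_eq_rpow]
    conv_rhs => rw [← Real.rpow_one_add' hy (by norm_num)]
    norm_num
  have h1 : √(1 + |t|) ≤ η * (1 + |t|) + 1 / (4 * η) := by
    rw [Real.sqrt_le_left (by positivity)]
    have : (η * (1 + |t|) + 1 / (4 * η)) ^ 2
      = (η * (1 + |t|) - 1 / (4 * η)) ^ 2 + (1 + |t|) := by field_simp; ring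
    nlinarith [sq_nonneg (η * (1 + |t|) - 1 / (4 * η))]
  have h2 : (1 + |t|) / (4 * η) ≤ η * (1 + |t|) ^ 2 + 1 / (64 * η ^ 3) := by
    have : η * (1 + |t|) ^ 2 + 1 / (64 * η ^ 3) - (1 + |t|) / (4 * η)
      = η * ((1 + |t|) - 1 / (8 * η ^ 2)) ^ 2 := by field_simp; ring
    have : 0 ≤ η * ((1 + |t|) - 1 / (8 * η ^ 2)) ^ 2 := by positivity
    linarith
  have h3 : vertError t ≤ 2 * η * (1 + |t|) ^ 2 + 1 / (64 * η ^ 3) := by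
    rw [e]
    have := mul_le_mul_of_nonneg_left h1 hy
    have e2 : (1 + |t|) * (η * (1 + |t|) + 1 / (4 * η))
      = η * (1 + |t|) ^ 2 + (1 + |t|) / (4 * η) := by field_simp
    linarith
  have h4 : (1 + |t|) ^ 2 ≤ 2 + 2 * t ^ 2 := by
    rw [← sq_abs t]
    nlinarith [sq_nonneg (1 - |t|)]
  have h5 : |K| * η * 4 ≤ ε := by
    rw [hη]
    have : |K| * (ε / (4 * (|K| + 1))) * 4 = ε * (|K| / (|K| + 1)) := by field_simp
    rw [this]
    refine mul_le_of_le_one_right hε.le ?_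
    rw [div_le_one (by positivity)]
    linarith
  have h6 : 0 ≤ vertError t := zero_le_one.trans (one_le_vertError t)
  calc K * vertError t ≤ |K| * vertError t := by gcongr; exact le_abs_self K
    _ ≤ |K| * (2 * η * (2 + 2 * t ^ 2) + 1 / (64 * η ^ 3)) := by
      gcongr
      exact h3.trans (by gcongr)
    _ = |K| * η * 4 * (1 + t ^ 2) + |K| * (1 / (64 * η ^ 3)) := by ring
    _ ≤ ε * (1 + t ^ 2) + |K| * (1 / (64 * η ^ 3)) := by gcongr
    _ = _ := by ring

section vertSize

variable {τ : ℝ}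

lemma vertSize_pos (hτ : 0 < τ) (t : ℝ) : 0 < vertSize τ t :=
  mul_pos (Real.exp_pos _) (norm_pos_iff.2 (canonProd_ne_zero (invLattice_nonneg hτ)
    (invLattice_le hτ) (summable_invLattice_pow_three hτ)
    (summable_invLattice_rpow hτ (by norm_num)) (by simp)))

lemma vertSize_neg (hτ : 0 < τ) (t : ℝ) : vertSize τ (-t) = vertSize τ t := by
  unfold vertSize
  rw [← norm_canonProd_conj (invLattice_nonneg hτ) (invLattice_le hτ)
    (summable_invLattice_pow_three hτ) (t * Complex.I)]
  simp

lemma exists_vertSize_le (hτ : 0 < τ) (M : ℝ) :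
    ∃ C : ℝ, 0 < C ∧ ∀ t : ℝ, vertSize τ t ≤ C * Real.exp (-(M * t ^ 2)) := by
  set β := (bBarnes τ / (2 * τ)).re
  obtain ⟨C, hC, h⟩ := norm_canonProd_mul_I_le (invLattice_nonneg hτ) (invLattice_le hτ)
    (summable_invLattice_pow_three hτ) (not_summable_invLattice_sq hτ) (abs_nonneg (M - β))
  refine ⟨C, hC, fun t => ?_⟩
  calc vertSize τ t ≤ Real.exp (-(β * t ^ 2)) * (C * Real.exp (-(|M - β| * t ^ 2))) :=
        mul_le_mul_of_nonneg_left (h t) (Real.exp_nonneg _)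
    _ = C * Real.exp (-(β * t ^ 2) + -(|M - β| * t ^ 2)) := by rw [Real.exp_add]; ring
    _ ≤ _ := by
      gcongr
      nlinarith [le_abs_self (M - β), sq_nonneg t]

lemma norm_sub_mul_I_le {z : ℂ} {t R : ℝ} (hre : |z.re| ≤ R) (him : |z.im - t| ≤ R) :
    ‖z - t * Complex.I‖ ≤ 2 * R := by
  refine (Complex.norm_le_abs_re_add_abs_im _).trans ?_
  simp
  linarith

lemma norm_le_of_re_of_im {z : ℂ} {t R : ℝ} (hre : |z.re| ≤ R) (him : |z.im - t| ≤ R) :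
    ‖z‖ ≤ |t| + 2 * R := by
  calc ‖z‖ = ‖t * Complex.I + (z - t * Complex.I)‖ := by ring_nf
    _ ≤ _ := (norm_add_le _ _).trans
      (by simpa using norm_sub_mul_I_le hre him)

lemma exists_abs_quadratic_re_le (A B : ℂ) {R : ℝ} (hR : 0 ≤ R) :
    ∃ K : ℝ, ∀ z : ℂ, ∀ t : ℝ, |z.re| ≤ R → |z.im - t| ≤ R →
      |(A * z + B * z ^ 2).re + B.re * t ^ 2| ≤ K * vertError t := by
  refine ⟨‖A‖ * (1 + 2 * R) + ‖B‖ * (4 * R + 4 * R ^ 2), fun z t hre him => ?_⟩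
  set δ := z - t * Complex.I with hδ
  have hδR : ‖δ‖ ≤ 2 * R := norm_sub_mul_I_le hre him
  have e : (A * z + B * z ^ 2).re + B.re * t ^ 2
      = (A * z + B * (2 * t * Complex.I * δ + δ ^ 2)).re := by
    have : A * z + B * z ^ 2 = A * z + B * (2 * t * Complex.I * δ + δ ^ 2)
        - ((t ^ 2 : ℝ) : ℂ) * B := by
      rw [hδ]
      push_cast
      linear_combination (B * t ^ 2) * Complex.I_sq
    rw [this, Complex.sub_re, Complex.re_ofReal_mul]
    ring
  rw [e]
  refine (Complex.abs_re_le_norm _).trans ((norm_add_le _ _).trans ?_)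
  rw [norm_mul, norm_mul]
  have h1 : ‖z‖ ≤ (1 + 2 * R) * vertError t := by
    have := norm_le_of_re_of_im hre him
    have := one_add_abs_le_vertError t
    have := one_le_vertError t
    nlinarith
  have h2 : ‖2 * t * Complex.I * δ + δ ^ 2‖ ≤ (4 * R + 4 * R ^ 2) * vertError t := by
    have h3 : ‖2 * t * Complex.I * δ + δ ^ 2‖ ≤ 2 * |t| * ‖δ‖ + ‖δ‖ ^ 2 :=
      (norm_add_le _ _).trans (by simp)
    have h4 : 2 * |t| * ‖δ‖ + ‖δ‖ ^ 2 ≤ 2 * |t| * (2 * R) + (2 * R) ^ 2 := by gcongr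
    have h5 := one_add_abs_le_vertError t
    have h6 := one_le_vertError t
    have h7 : |t| ≤ vertError t := by linarith
    have := mul_le_mul_of_nonneg_left h7 hR
    have := mul_le_mul_of_nonneg_left h6 (sq_nonneg R)
    nlinarith
  have := mul_le_mul_of_nonneg_left h1 (norm_nonneg A)
  have := mul_le_mul_of_nonneg_left h2 (norm_nonneg B)
  linarith

lemma norm_barnesG (τ : ℝ) (z : ℂ) : ‖barnesG z τ‖ = ‖z / τ‖ *
    Real.exp (aBarnes τ / τ * z + bBarnes τ / (2 * τ) * z ^ 2).re *
      ‖canonProd (invLattice τ) z‖ := by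
  have e : aBarnes τ * z / τ + bBarnes τ * z ^ 2 / (2 * τ)
      = aBarnes τ / τ * z + bBarnes τ / (2 * τ) * z ^ 2 := by ring
  rw [barnesG_eq_canonProd, norm_mul, norm_mul, Complex.norm_exp, e]

lemma exists_norm_canonProd_le (hτ : 0 < τ) {R : ℝ} (hR : 0 ≤ R) :
    ∃ K : ℝ, ∀ z z' : ℂ, ∀ t : ℝ, -R ≤ z.re → 0 ≤ z'.re → ‖z‖ ≤ |t| + 2 * R →
      ‖z'‖ ≤ |t| + 2 * R → ‖z - z'‖ ≤ 2 * R → ‖canonProd (invLattice τ) z‖ ≤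
        ‖canonProd (invLattice τ) z'‖ * Real.exp (K * vertError t) := by
  set S := ∑' i, invLattice τ i ^ (5 / 2 : ℝ)
  have hS : 0 ≤ S := tsum_nonneg fun i => Real.rpow_nonneg (invLattice_nonneg hτ i) _
  refine ⟨(3 * (1 + 4 * R) ^ (3 / 2 : ℝ) * (4 * R) + (2 * R) ^ (5 / 2 : ℝ)) * S,
    fun z z' t hz hz' hzn hzn' hzz => ?_⟩
  refine (norm_canonProd_le (invLattice_nonneg hτ) (invLattice_le hτ)
    (summable_invLattice_pow_three hτ) (summable_invLattice_rpow hτ (by norm_num)) hR hz hz'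
    (M := (1 + 4 * R) * (1 + |t|)) ?_ ?_).trans ?_
  · nlinarith [abs_nonneg t]
  · nlinarith [abs_nonneg t]
  · refine mul_le_mul_of_nonneg_left (Real.exp_le_exp.2 ?_) (norm_nonneg _)
    rw [Real.mul_rpow (by positivity) (by positivity), mul_right_comm _ S]
    refine mul_le_mul_of_nonneg_right ?_ hS
    change 3 * ((1 + 4 * R) ^ (3 / 2 : ℝ) * vertError t) * _ + _ ≤ _
    have h1 := one_le_vertError t
    have h2 : 0 ≤ (2 * R) ^ (5 / 2 : ℝ) := by positivity
    have h3 : 0 ≤ (1 + 4 * R) ^ (3 / 2 : ℝ) := by positivity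
    have h4 : 3 * ((1 + 4 * R) ^ (3 / 2 : ℝ) * vertError t) * (‖z - z'‖ + 2 * R)
      ≤ 3 * ((1 + 4 * R) ^ (3 / 2 : ℝ) * vertError t) * (2 * R + 2 * R) := by gcongr
    nlinarith

lemma exists_norm_barnesG_le (hτ : 0 < τ) {R : ℝ} (hR : 0 ≤ R) :
    ∃ K : ℝ, ∀ z : ℂ, ∀ t : ℝ, |z.re| ≤ R → |z.im - t| ≤ R →
      ‖barnesG z τ‖ ≤ Real.exp (K * vertError t) * vertSize τ t := by
  obtain ⟨K₁, h₁⟩ := exists_abs_quadratic_re_le (aBarnes τ / τ) (bBarnes τ / (2 * τ)) hR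
  obtain ⟨K₂, h₂⟩ := exists_norm_canonProd_le hτ hR
  refine ⟨(1 + 2 * R) / τ + K₁ + K₂, fun z t hre him => ?_⟩
  have hz := norm_le_of_re_of_im hre him
  have ha : ‖z / τ‖ ≤ Real.exp ((1 + 2 * R) / τ * vertError t) := by
    rw [norm_div, Complex.norm_real, Real.norm_of_nonneg hτ.le]
    have h3 : ‖z‖ / τ ≤ (1 + 2 * R) / τ * vertError t := by
      rw [div_mul_eq_mul_div]
      gcongr
      nlinarith [one_add_abs_le_vertError t, one_le_vertError t]
    linarith [Real.add_one_le_exp ((1 + 2 * R) / τ * vertError t)]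
  have hb := (abs_le.1 (h₁ z t hre him)).2
  have hc := h₂ z (t * Complex.I) t (by linarith [(abs_le.1 hre).1]) (by simp) hz
    (by simp [hR]) (norm_sub_mul_I_le hre him)
  rw [norm_barnesG, vertSize]
  calc _ ≤ Real.exp ((1 + 2 * R) / τ * vertError t) *
        Real.exp (K₁ * vertError t + -((bBarnes τ / (2 * τ)).re * t ^ 2)) *
        (‖canonProd (invLattice τ) (t * Complex.I)‖ * Real.exp (K₂ * vertError t)) := by
        gcongr
        linarith
    _ = _ := by
        rw [add_mul, add_mul, Real.exp_add, Real.exp_add, Real.exp_add]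
        ring

lemma exists_vertSize_le_norm_barnesG (hτ : 0 < τ) {R δ : ℝ} (hR : 0 ≤ R) (hδ : 0 < δ) :
    ∃ K : ℝ, ∀ z : ℂ, ∀ t : ℝ, δ ≤ z.re → |z.re| ≤ R → |z.im - t| ≤ R →
      vertSize τ t ≤ Real.exp (K * vertError t) * ‖barnesG z τ‖ := by
  obtain ⟨K₁, h₁⟩ := exists_abs_quadratic_re_le (aBarnes τ / τ) (bBarnes τ / (2 * τ)) hR
  obtain ⟨K₂, h₂⟩ := exists_norm_canonProd_le hτ hR
  refine ⟨τ / δ + K₁ + K₂, fun z t hδz hre him => ?_⟩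
  have hz := norm_le_of_re_of_im hre him
  have ha : 1 ≤ Real.exp (τ / δ * vertError t) * ‖z / τ‖ := by
    rw [norm_div, Complex.norm_real, Real.norm_of_nonneg hτ.le]
    have h3 : δ ≤ ‖z‖ := hδz.trans (Complex.re_le_norm z)
    have h4 : τ / δ ≤ Real.exp (τ / δ * vertError t) := by
      have : τ / δ * 1 ≤ τ / δ * vertError t := by
        gcongr
        exact one_le_vertError t
      linarith [Real.add_one_le_exp (τ / δ * vertError t)]
    calc (1 : ℝ) = τ / δ * (δ / τ) := by field_simp
      _ ≤ _ := by gcongr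
  have hb := (abs_le.1 (h₁ z t hre him)).1
  have hc := h₂ (t * Complex.I) z t (by simpa using hR) (hδ.le.trans hδz)
    (by simp [hR]) hz (by rw [norm_sub_rev]; exact norm_sub_mul_I_le hre him)
  rw [norm_barnesG, vertSize]
  calc _ ≤ 1 * Real.exp (K₁ * vertError t +
          (aBarnes τ / τ * z + bBarnes τ / (2 * τ) * z ^ 2).re) *
        (‖canonProd (invLattice τ) z‖ * Real.exp (K₂ * vertError t)) := by
        rw [one_mul]
        gcongr
        linarith
    _ ≤ (Real.exp (τ / δ * vertError t) * ‖z / τ‖) * Real.exp (K₁ * vertError t +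
          (aBarnes τ / τ * z + bBarnes τ / (2 * τ) * z ^ 2).re) *
        (‖canonProd (invLattice τ) z‖ * Real.exp (K₂ * vertError t)) := by gcongr
    _ = _ := by
        rw [add_mul, add_mul, Real.exp_add, Real.exp_add, Real.exp_add]
        ring

end vertSize

section FiniteProducts

variable {X : Type*} {S : Set X} {k : ℕ} {P : Fin k → Prop} [DecidablePred P]
  {f : Fin k → X → ℂ} {E Q : X → ℝ}

lemma exists_norm_prod_ite_le
    (h : ∀ j, P j → ∃ K : ℝ, ∀ x ∈ S, ‖f j x‖ ≤ Real.exp (K * E x) * Q x) :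
    ∃ K : ℝ, ∀ x ∈ S, ‖∏ j, if P j then f j x else 1‖ ≤
      Real.exp (K * E x) * Q x ^ (Finset.univ.filter P).card := by
  choose! K hK using h
  refine ⟨∑ j ∈ Finset.univ.filter P, K j, fun x hx => ?_⟩
  rw [← Finset.prod_filter, norm_prod]
  refine (Finset.prod_le_prod (fun _ _ => norm_nonneg _)
    fun j hj => hK j (Finset.mem_filter.1 hj).2 x hx).trans_eq ?_
  rw [Finset.prod_mul_distrib, ← Real.exp_sum, ← Finset.sum_mul, Finset.prod_const]

lemma exists_le_norm_prod_ite (hQ : ∀ x, 0 ≤ Q x)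
    (h : ∀ j, P j → ∃ K : ℝ, ∀ x ∈ S, Q x ≤ Real.exp (K * E x) * ‖f j x‖) :
    ∃ K : ℝ, ∀ x ∈ S, Q x ^ (Finset.univ.filter P).card ≤
      Real.exp (K * E x) * ‖∏ j, if P j then f j x else 1‖ := by
  choose! K hK using h
  refine ⟨∑ j ∈ Finset.univ.filter P, K j, fun x hx => ?_⟩
  rw [← Finset.prod_filter, norm_prod, ← Finset.prod_const, Finset.sum_mul, Real.exp_sum,
    ← Finset.prod_mul_distrib]
  exact Finset.prod_le_prod (fun _ _ => hQ x)
    fun j hj => hK j (Finset.mem_filter.1 hj).2 x hx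

end FiniteProducts

lemma card_filter_le_val (q m : ℕ) : (Finset.univ.filter fun j : Fin q => m ≤ (j : ℕ)).card
    = q - m := by
  have h := Finset.card_filter_add_card_filter_not (s := Finset.univ)
    (fun j : Fin q => (j : ℕ) < m)
  simp only [not_lt, Fin.card_filter_val_lt, Finset.card_univ, Fintype.card_fin] at h
  omega

section Strip

variable {τ c₁ c₂ : ℝ}

lemma strip_bounds (d : ℂ) {c : ℝ} (hc : c ∈ Set.Icc c₁ c₂) (t : ℝ) :
    (|(d - (c + t * Complex.I)).re| ≤ ‖d‖ + |c₁| + |c₂| ∧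
      |(d - (c + t * Complex.I)).im - -t| ≤ ‖d‖ + |c₁| + |c₂|) ∧
    (|(d + (c + t * Complex.I)).re| ≤ ‖d‖ + |c₁| + |c₂| ∧
      |(d + (c + t * Complex.I)).im - t| ≤ ‖d‖ + |c₁| + |c₂|) := by
  have h1 := Complex.abs_re_le_norm d
  have h2 := Complex.abs_im_le_norm d
  have hc' : |c| ≤ |c₁| + |c₂| := by
    refine (abs_le_max_abs_abs hc.1 hc.2).trans (max_le ?_ ?_) <;>
      linarith [abs_nonneg c₁, abs_nonneg c₂]
  have h3 := abs_sub d.re c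
  have h4 := abs_add_le d.re c
  refine ⟨⟨?_, ?_⟩, ?_, ?_⟩ <;> simp <;>
    linarith [abs_nonneg c₁, abs_nonneg c₂]

lemma exists_norm_barnesG_sub_le (hτ : 0 < τ) (d : ℂ) :
    ∃ K : ℝ, ∀ x ∈ Set.Icc c₁ c₂ ×ˢ (Set.univ : Set ℝ),
      ‖barnesG (d - (x.1 + x.2 * Complex.I)) τ‖ ≤
        Real.exp (K * vertError x.2) * vertSize τ x.2 := by
  obtain ⟨K, hK⟩ := exists_norm_barnesG_le hτ (R := ‖d‖ + |c₁| + |c₂|) (by positivity)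
  refine ⟨K, fun x hx => ?_⟩
  have hb := (strip_bounds d hx.1 x.2).1
  have := hK _ (-x.2) hb.1 hb.2
  rwa [vertError_neg, vertSize_neg hτ] at this

lemma exists_norm_barnesG_add_le (hτ : 0 < τ) (d : ℂ) :
    ∃ K : ℝ, ∀ x ∈ Set.Icc c₁ c₂ ×ˢ (Set.univ : Set ℝ),
      ‖barnesG (d + (x.1 + x.2 * Complex.I)) τ‖ ≤
        Real.exp (K * vertError x.2) * vertSize τ x.2 := by
  obtain ⟨K, hK⟩ := exists_norm_barnesG_le hτ (R := ‖d‖ + |c₁| + |c₂|) (by positivity)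
  refine ⟨K, fun x hx => ?_⟩
  have hb := (strip_bounds d hx.1 x.2).2
  exact hK _ x.2 hb.1 hb.2

lemma exists_vertSize_le_norm_barnesG_sub (hτ : 0 < τ) {d : ℂ} (hd : c₂ < d.re) :
    ∃ K : ℝ, ∀ x ∈ Set.Icc c₁ c₂ ×ˢ (Set.univ : Set ℝ),
      vertSize τ x.2 ≤
        Real.exp (K * vertError x.2) * ‖barnesG (d - (x.1 + x.2 * Complex.I)) τ‖ := by
  obtain ⟨K, hK⟩ := exists_vertSize_le_norm_barnesG hτ (R := ‖d‖ + |c₁| + |c₂|) (by positivity)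
    (sub_pos.2 hd)
  refine ⟨K, fun x hx => ?_⟩
  have hb := (strip_bounds d hx.1 x.2).1
  have := hK (d - (x.1 + x.2 * Complex.I)) (-x.2) (by
    have := hx.1.2
    simp
    linarith) hb.1 hb.2
  rwa [vertError_neg, vertSize_neg hτ] at this

lemma exists_vertSize_le_norm_barnesG_add (hτ : 0 < τ) {d : ℂ} (hd : 0 < d.re + c₁) :
    ∃ K : ℝ, ∀ x ∈ Set.Icc c₁ c₂ ×ˢ (Set.univ : Set ℝ),
      vertSize τ x.2 ≤
        Real.exp (K * vertError x.2) * ‖barnesG (d + (x.1 + x.2 * Complex.I)) τ‖ := by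
  obtain ⟨K, hK⟩ := exists_vertSize_le_norm_barnesG hτ (R := ‖d‖ + |c₁| + |c₂|) (by positivity) hd
  refine ⟨K, fun x hx => ?_⟩
  have hb := (strip_bounds d hx.1 x.2).2
  exact hK (d + (x.1 + x.2 * Complex.I)) x.2 (by simpa using hx.1.1) hb.1 hb.2

variable {m n p q : ℕ} {a : Fin p → ℂ} {b : Fin q → ℂ}

lemma differentiableAt_calG (hτ : 0 < τ) {s : ℂ}
    (hb : ∀ j : Fin q, m ≤ (j : ℕ) → (b j).re - τ - 1 < s.re)
    (ha : ∀ k : Fin p, n ≤ (k : ℕ) → s.re < (a k).re) :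
    DifferentiableAt ℂ (fun s => calG m n a b s τ) s := by
  have hd := differentiable_barnesG hτ
  have hG : ∀ g : ℂ → ℂ, Differentiable ℂ g →
      DifferentiableAt ℂ (fun s => barnesG (g s) τ) s := fun g hg => hd.comp hg s
  refine DifferentiableAt.div (DifferentiableAt.mul ?_ ?_) (DifferentiableAt.mul ?_ ?_)
    (mul_ne_zero ?_ ?_)
  · refine DifferentiableAt.fun_finsetProd fun j _ => ?_
    split_ifs
    exacts [hG _ (by fun_prop), differentiableAt_const _]
  · refine DifferentiableAt.fun_finsetProd fun j _ => ?_
    split_ifs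
    exacts [hG _ (by fun_prop), differentiableAt_const _]
  · refine DifferentiableAt.fun_finsetProd fun j _ => ?_
    split_ifs
    exacts [hG _ (by fun_prop), differentiableAt_const _]
  · refine DifferentiableAt.fun_finsetProd fun j _ => ?_
    split_ifs
    exacts [hG _ (by fun_prop), differentiableAt_const _]
  · refine Finset.prod_ne_zero_iff.2 fun j _ => ?_
    split_ifs with h
    · refine barnesG_ne_zero hτ ?_
      have := hb j h
      simp
      linarith
    · exact one_ne_zero
  · refine Finset.prod_ne_zero_iff.2 fun j _ => ?_
    split_ifs with h
    · refine barnesG_ne_zero hτ ?_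
      have := ha j h
      simp
      linarith
    · exact one_ne_zero

lemma exists_norm_calG_le (hτ : 0 < τ) (hm : m ≤ q) (hn : n ≤ p)
    (hb : ∀ j : Fin q, m ≤ (j : ℕ) → (b j).re - τ - 1 < c₁)
    (ha : ∀ k : Fin p, n ≤ (k : ℕ) → c₂ < (a k).re) (hN : 0 ≤ paramN m n p q) :
    ∃ K : ℝ, ∀ c ∈ Set.Icc c₁ c₂, ∀ t : ℝ, ‖calG m n a b (c + t * Complex.I) τ‖ ≤
      Real.exp (K * vertError t) * vertSize τ t ^ (paramN m n p q).toNat := by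
  have hQ : ∀ x : ℝ × ℝ, 0 ≤ vertSize τ x.2 := fun x => (vertSize_pos hτ x.2).le
  obtain ⟨K₁, h₁⟩ := exists_norm_prod_ite_le (P := fun j : Fin q => (j : ℕ) < m)
    (S := Set.Icc c₁ c₂ ×ˢ (Set.univ : Set ℝ)) (E := fun x => vertError x.2)
    (Q := fun x => vertSize τ x.2)
    (f := fun j x => barnesG (b j - (x.1 + x.2 * Complex.I)) τ)
    fun j _ => exists_norm_barnesG_sub_le hτ (b j)
  obtain ⟨K₂, h₂⟩ := exists_norm_prod_ite_le (P := fun j : Fin p => (j : ℕ) < n)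
    (S := Set.Icc c₁ c₂ ×ˢ (Set.univ : Set ℝ)) (E := fun x => vertError x.2)
    (Q := fun x => vertSize τ x.2)
    (f := fun j x => barnesG (1 + τ - a j + (x.1 + x.2 * Complex.I)) τ)
    fun j _ => exists_norm_barnesG_add_le hτ (1 + τ - a j)
  obtain ⟨K₃, h₃⟩ := exists_le_norm_prod_ite (P := fun j : Fin q => m ≤ (j : ℕ))
    (S := Set.Icc c₁ c₂ ×ˢ (Set.univ : Set ℝ)) (E := fun x => vertError x.2)
    (Q := fun x => vertSize τ x.2)
    (f := fun j x => barnesG (1 + τ - b j + (x.1 + x.2 * Complex.I)) τ) hQ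
    fun j hj => exists_vertSize_le_norm_barnesG_add hτ (d := 1 + τ - b j) (by
      have := hb j hj
      simp
      linarith)
  obtain ⟨K₄, h₄⟩ := exists_le_norm_prod_ite (P := fun j : Fin p => n ≤ (j : ℕ))
    (S := Set.Icc c₁ c₂ ×ˢ (Set.univ : Set ℝ)) (E := fun x => vertError x.2)
    (Q := fun x => vertSize τ x.2)
    (f := fun j x => barnesG (a j - (x.1 + x.2 * Complex.I)) τ) hQ
    fun j hj => exists_vertSize_le_norm_barnesG_sub hτ (ha j hj)
  simp only [Fin.card_filter_val_lt, card_filter_le_val, min_eq_right hm, min_eq_right hn]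
    at h₁ h₂ h₃ h₄
  have hcard : m + n = (paramN m n p q).toNat + ((q - m) + (p - n)) := by
    unfold paramN at hN ⊢
    omega
  refine ⟨K₁ + K₂ + (K₃ + K₄), fun c hc t => ?_⟩
  have hx : ((c, t) : ℝ × ℝ) ∈ Set.Icc c₁ c₂ ×ˢ (Set.univ : Set ℝ) := ⟨hc, Set.mem_univ _⟩
  have hT := vertSize_pos hτ t
  have hnum := mul_le_mul (h₁ _ hx) (h₂ _ hx) (norm_nonneg _) (by positivity)
  have hden := mul_le_mul (h₃ _ hx) (h₄ _ hx) (by positivity) (by positivity)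
  rw [← norm_mul] at hnum
  rw [mul_mul_mul_comm, ← norm_mul] at hden
  dsimp only at hnum hden
  have hpos : 0 < Real.exp (K₃ * vertError t) * Real.exp (K₄ * vertError t) := by positivity
  have hden' := (div_le_iff₀' hpos).2 hden
  unfold calG
  rw [norm_div]
  refine (div_le_div₀ (by positivity) hnum (by positivity) hden').trans_eq ?_
  rw [mul_mul_mul_comm, ← pow_add, ← pow_add, hcard, pow_add, add_mul, add_mul, add_mul,
    Real.exp_add, Real.exp_add, Real.exp_add]
  field_simp

/-- On a closed strip, the `w`-independent part of the integrand has uniform Gaussian decay. -/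
lemma exists_norm_integrand_le (hτ : 0 < τ) (α : ℂ) (hm : m ≤ q) (hn : n ≤ p)
    (hb : ∀ j : Fin q, m ≤ (j : ℕ) → (b j).re - τ - 1 < c₁)
    (ha : ∀ k : Fin p, n ≤ (k : ℕ) → c₂ < (a k).re)
    (hcase : 0 < paramN m n p q ∨ (paramN m n p q = 0 ∧ 0 < α.re)) :
    ∃ C κ : ℝ, 0 ≤ C ∧ 0 < κ ∧ ∀ c ∈ Set.Icc c₁ c₂, ∀ t : ℝ,
      ‖calG m n a b (c + t * Complex.I) τ *
        Complex.exp ((Real.pi : ℂ) * α / τ * (c + t * Complex.I) ^ 2)‖ ≤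
          C * Real.exp (-(κ * t ^ 2)) := by
  set A : ℂ := (Real.pi : ℂ) * α / τ with hA
  have hAre : A.re = Real.pi * α.re / τ := by
    rw [hA, Complex.div_ofReal_re, Complex.re_ofReal_mul]
  obtain ⟨K₁, h₁⟩ := exists_norm_calG_le hτ hm hn hb ha (by omega)
  obtain ⟨K₂, h₂⟩ := exists_abs_quadratic_re_le 0 A (R := |c₁| + |c₂|) (by positivity)
  obtain ⟨M, C, hM, hC, hQ⟩ : ∃ M C : ℝ, 0 < A.re + M ∧ 0 < C ∧ ∀ t : ℝ,
      vertSize τ t ^ (paramN m n p q).toNat ≤ C * Real.exp (-(M * t ^ 2)) := by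
    rcases hcase with hN | ⟨hN, hα⟩
    · obtain ⟨C, hC, hQ⟩ := exists_vertSize_le hτ (|A.re| + 1)
      refine ⟨|A.re| + 1, C ^ (paramN m n p q).toNat, by linarith [neg_abs_le A.re],
        by positivity, fun t => ?_⟩
      refine (pow_le_pow_left₀ (vertSize_pos hτ t).le (hQ t) _).trans ?_
      rw [mul_pow]
      gcongr
      refine pow_le_of_le_one (Real.exp_nonneg _) (Real.exp_le_one_iff.2 ?_) (by omega)
      have : 0 ≤ (|A.re| + 1) * t ^ 2 := by positivity
      linarith
    · refine ⟨0, 1, ?_, one_pos, fun t => ?_⟩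
      · rw [hAre]
        have := Real.pi_pos
        positivity
      · simp [hN]
  obtain ⟨D, hD⟩ := exists_mul_vertError_le (K₁ + K₂) (half_pos hM)
  refine ⟨C * Real.exp D, (A.re + M) / 2, by positivity, half_pos hM, fun c hc t => ?_⟩
  have hs := (strip_bounds 0 hc t).2
  rw [norm_zero, zero_add, zero_add] at hs
  have h₃ := (abs_le.1 (h₂ _ t hs.1 hs.2)).2
  rw [zero_mul, zero_add] at h₃
  rw [norm_mul, Complex.norm_exp]
  calc _ ≤ (Real.exp (K₁ * vertError t) * (C * Real.exp (-(M * t ^ 2)))) *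
        Real.exp (K₂ * vertError t - A.re * t ^ 2) := by
        refine mul_le_mul ((h₁ c hc t).trans ?_) (Real.exp_le_exp.2 (by linarith))
          (Real.exp_nonneg _) (by positivity)
        exact mul_le_mul_of_nonneg_left (hQ t) (Real.exp_nonneg _)
    _ = C * Real.exp (K₁ * vertError t + -(M * t ^ 2) + (K₂ * vertError t - A.re * t ^ 2)) := by
        rw [Real.exp_add, Real.exp_add]
        ring
    _ ≤ C * Real.exp (D + -((A.re + M) / 2 * t ^ 2)) := by
        refine mul_le_mul_of_nonneg_left (Real.exp_le_exp.2 ?_) hC.le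
        linarith [hD t]
    _ = _ := by
        rw [Real.exp_add]
        ring

end Strip

section VerticalIntegrals

variable {F : ℂ → ℂ} {C κ c c' : ℝ}

lemma exists_exp_mul_abs_mul_gaussian_le (hκ : 0 < κ) (B : ℝ) :
    ∃ D : ℝ, 0 < D ∧ ∀ t : ℝ, Real.exp (B * |t|) * Real.exp (-(κ * t ^ 2)) ≤
      D * Real.exp (-(κ / 2) * t ^ 2) := by
  refine ⟨Real.exp (B ^ 2 / (2 * κ)), Real.exp_pos _, fun t => ?_⟩
  rw [← Real.exp_add, ← Real.exp_add, Real.exp_le_exp]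
  have h : B ^ 2 / (2 * κ) + -(κ / 2) * t ^ 2 - (B * |t| + -(κ * t ^ 2))
      = (B - κ * |t|) ^ 2 / (2 * κ) := by
    have : (B - κ * |t|) ^ 2 = B ^ 2 - 2 * B * κ * |t| + κ ^ 2 * t ^ 2 := by
      rw [← sq_abs t]; ring
    rw [this]
    field_simp
    ring
  have : 0 ≤ (B - κ * |t|) ^ 2 / (2 * κ) := by positivity
  linarith

lemma norm_exp_neg_mul_line_le (w : ℂ) (c t : ℝ) {W : ℝ} (hw : ‖w‖ ≤ W) :
    ‖Complex.exp (-(2 * Real.pi * w * (c + t * Complex.I)))‖ ≤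
      Real.exp (2 * Real.pi * W * |c|) * Real.exp (2 * Real.pi * W * |t|) := by
  refine (Complex.norm_exp_le_exp_norm _).trans ?_
  rw [← Real.exp_add, Real.exp_le_exp, norm_neg, norm_mul, ← mul_add]
  have hpi := Real.pi_pos
  have h1 : ‖(2 * Real.pi * w : ℂ)‖ ≤ 2 * Real.pi * W := by
    rw [norm_mul, norm_mul, Complex.norm_real, Complex.norm_ofNat, Real.norm_of_nonneg hpi.le]
    gcongr
  have h2 : ‖(c + t * Complex.I : ℂ)‖ ≤ |c| + |t| := (norm_add_le _ _).trans (by simp)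
  exact mul_le_mul h1 h2 (norm_nonneg _) ((norm_nonneg _).trans h1)

/-- Gaussian bound for a Gaussian-decaying function times an exponential and a linear factor. -/
lemma exists_norm_mul_exp_le (hκ : 0 < κ) (hC : 0 ≤ C) (c₀ W : ℝ) :
    ∃ D : ℝ, ∀ c t : ℝ, ∀ w : ℂ, |c| ≤ c₀ → ‖w‖ ≤ W →
      ‖F (c + t * Complex.I)‖ ≤ C * Real.exp (-(κ * t ^ 2)) →
      ‖F (c + t * Complex.I) * Complex.exp (-(2 * Real.pi * w * (c + t * Complex.I)))‖ *
        (1 + |c| + |t|) ≤ D * Real.exp (-(κ / 2) * t ^ 2) := by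
  obtain ⟨D, hD, h⟩ := exists_exp_mul_abs_mul_gaussian_le hκ (2 * Real.pi * W + 1)
  refine ⟨C * Real.exp (2 * Real.pi * W * c₀ + c₀) * D, fun c t w hc hw hF => ?_⟩
  have hpi := Real.pi_pos
  have hW : 0 ≤ W := (norm_nonneg _).trans hw
  have h1 := norm_exp_neg_mul_line_le w c t hw
  have h2 : 1 + |c| + |t| ≤ Real.exp (|c| + |t|) := by
    linarith [Real.add_one_le_exp (|c| + |t|)]
  rw [norm_mul]
  calc _ ≤ C * Real.exp (-(κ * t ^ 2)) * (Real.exp (2 * Real.pi * W * |c|) *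
        Real.exp (2 * Real.pi * W * |t|)) * Real.exp (|c| + |t|) := by gcongr
    _ = C * Real.exp (2 * Real.pi * W * |c| + |c|) *
        (Real.exp ((2 * Real.pi * W + 1) * |t|) * Real.exp (-(κ * t ^ 2))) := by
        rw [add_mul, Real.exp_add, Real.exp_add, Real.exp_add, one_mul]
        ring
    _ ≤ C * Real.exp (2 * Real.pi * W * c₀ + c₀) * (D * Real.exp (-(κ / 2) * t ^ 2)) := by
        refine mul_le_mul ?_ (h t) (by positivity) (by positivity)
        gcongr
    _ = _ := by ring

lemma continuous_vertical_line {G : ℂ → ℂ} {c : ℝ}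
    (hG : ∀ s : ℂ, s.re = c → ContinuousAt G s) :
    Continuous fun t : ℝ => G (c + t * Complex.I) := by
  refine continuous_iff_continuousAt.2 fun t => ?_
  exact ContinuousAt.comp (f := fun t : ℝ => (c + t * Complex.I : ℂ))
    (hG (c + t * Complex.I) (by simp)) (by fun_prop)

lemma differentiableAt_mul_exp {s : ℂ} (hF : DifferentiableAt ℂ F s) (w : ℂ) :
    DifferentiableAt ℂ (fun s => F s * Complex.exp (-(2 * Real.pi * w * s))) s := by
  fun_prop

lemma integrable_vertical (hκ : 0 < κ) (hC : 0 ≤ C)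
    (hd : ∀ s : ℂ, s.re = c → DifferentiableAt ℂ F s)
    (hF : ∀ t : ℝ, ‖F (c + t * Complex.I)‖ ≤ C * Real.exp (-(κ * t ^ 2))) (w : ℂ) :
    Integrable fun t : ℝ =>
      F (c + t * Complex.I) * Complex.exp (-(2 * Real.pi * w * (c + t * Complex.I))) := by
  obtain ⟨D, hD⟩ := exists_norm_mul_exp_le (F := F) hκ hC |c| ‖w‖
  refine ((integrable_exp_neg_mul_sq (half_pos hκ)).const_mul D).mono'
    (continuous_vertical_line fun s hs =>
      (differentiableAt_mul_exp (hd s hs) w).continuousAt).aestronglyMeasurable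
    (Eventually.of_forall fun t => ?_)
  refine le_trans ?_ (hD c t w le_rfl le_rfl (hF t))
  exact le_mul_of_one_le_right (norm_nonneg _) (by linarith [abs_nonneg c, abs_nonneg t])

lemma differentiable_integral_vertical (hκ : 0 < κ) (hC : 0 ≤ C)
    (hd : ∀ s : ℂ, s.re = c → DifferentiableAt ℂ F s)
    (hF : ∀ t : ℝ, ‖F (c + t * Complex.I)‖ ≤ C * Real.exp (-(κ * t ^ 2))) :
    Differentiable ℂ fun w : ℂ => ∫ t : ℝ,
      F (c + t * Complex.I) * Complex.exp (-(2 * Real.pi * w * (c + t * Complex.I))) := by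
  intro w₀
  obtain ⟨D, hD⟩ := exists_norm_mul_exp_le (F := F) hκ hC |c| (‖w₀‖ + 1)
  have hint := integrable_vertical hκ hC hd hF
  refine (hasDerivAt_integral_of_dominated_loc_of_deriv_le
    (F := fun (w : ℂ) (t : ℝ) =>
      F (c + t * Complex.I) * Complex.exp (-(2 * Real.pi * w * (c + t * Complex.I))))
    (F' := fun (w : ℂ) (t : ℝ) =>
      F (c + t * Complex.I) * Complex.exp (-(2 * Real.pi * w * (c + t * Complex.I))) *
        (-(2 * Real.pi * (c + t * Complex.I))))
    (bound := fun t => 2 * Real.pi * (D * Real.exp (-(κ / 2) * t ^ 2)))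
    (Metric.ball_mem_nhds w₀ one_pos) (Eventually.of_forall fun w => (hint w).1) (hint w₀)
    ?_ ?_ ?_ ?_).2.differentiableAt
  · refine Continuous.aestronglyMeasurable (Continuous.mul ?_ (by fun_prop))
    exact continuous_vertical_line fun s hs =>
      (differentiableAt_mul_exp (hd s hs) w₀).continuousAt
  · refine Eventually.of_forall fun t w hw => ?_
    have hw' : ‖w‖ ≤ ‖w₀‖ + 1 := by
      have h1 := norm_le_norm_add_norm_sub' w w₀
      have h2 : ‖w - w₀‖ < 1 := by simpa [dist_eq_norm] using hw
      linarith
    have h := hD c t w le_rfl hw' (hF t)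
    have h2 : ‖(c + t * Complex.I : ℂ)‖ ≤ 1 + |c| + |t| :=
      (norm_add_le _ _).trans (by simp)
    have hpi := Real.pi_pos
    have h3 : ‖-(2 * Real.pi * (c + t * Complex.I) : ℂ)‖ =
        2 * Real.pi * ‖(c + t * Complex.I : ℂ)‖ := by
      rw [norm_neg, norm_mul, norm_mul, Complex.norm_real, Complex.norm_ofNat,
        Real.norm_of_nonneg hpi.le]
    rw [norm_mul, h3]
    calc _ ≤ ‖F (c + t * Complex.I) * Complex.exp (-(2 * Real.pi * w * (c + t * Complex.I)))‖ *
          (2 * Real.pi * (1 + |c| + |t|)) := by gcongr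
      _ = 2 * Real.pi * (‖F (c + t * Complex.I) *
          Complex.exp (-(2 * Real.pi * w * (c + t * Complex.I)))‖ * (1 + |c| + |t|)) := by ring
      _ ≤ _ := by gcongr
  · exact ((integrable_exp_neg_mul_sq (half_pos hκ)).const_mul D).const_mul _
  · refine Eventually.of_forall fun t w _ => ?_
    have h : HasDerivAt (fun w : ℂ => -(2 * Real.pi * w * (c + t * Complex.I)))
        (-(2 * Real.pi * (c + t * Complex.I))) w := by
      refine ((((hasDerivAt_id' w).const_mul (2 * Real.pi : ℂ)).mul_const
        (c + t * Complex.I : ℂ)).neg).congr_deriv ?_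
      ring
    refine (h.cexp.const_mul (F (c + t * Complex.I))).congr_deriv ?_
    ring

lemma integral_vertical_eq (hκ : 0 < κ) (hC : 0 ≤ C) (hcc : c ≤ c')
    (hd : ∀ s : ℂ, s.re ∈ Set.Icc c c' → DifferentiableAt ℂ F s)
    (hF : ∀ x ∈ Set.Icc c c', ∀ t : ℝ,
      ‖F (x + t * Complex.I)‖ ≤ C * Real.exp (-(κ * t ^ 2))) (w : ℂ) :
    ∫ t : ℝ, F (c + t * Complex.I) * Complex.exp (-(2 * Real.pi * w * (c + t * Complex.I))) =
    ∫ t : ℝ, F (c' + t * Complex.I) *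
      Complex.exp (-(2 * Real.pi * w * (c' + t * Complex.I))) := by
  set G : ℂ → ℂ := fun s => F s * Complex.exp (-(2 * Real.pi * w * s)) with hG
  have hcm : c ∈ Set.Icc c c' := ⟨le_rfl, hcc⟩
  have hcm' : c' ∈ Set.Icc c c' := ⟨hcc, le_rfl⟩
  obtain ⟨D, hD⟩ := exists_norm_mul_exp_le (F := F) hκ hC (max |c| |c'|) ‖w‖
  have hGD : ∀ x ∈ Set.Icc c c', ∀ t : ℝ,
      ‖G (x + t * Complex.I)‖ ≤ D * Real.exp (-(κ / 2) * t ^ 2) := fun x hx t =>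
    le_trans (le_mul_of_one_le_right (norm_nonneg _) (by linarith [abs_nonneg x, abs_nonneg t]))
      (hD x t w (abs_le_max_abs_abs hx.1 hx.2) le_rfl (hF x hx t))
  have hint : ∀ x ∈ Set.Icc c c', Integrable fun t : ℝ => G (x + t * Complex.I) := fun x hx =>
    integrable_vertical hκ hC (fun s hs => hd s (hs ▸ hx)) (hF x hx) w
  have hvert : ∀ x ∈ Set.Icc c c', Tendsto (fun T : ℝ => ∫ t in (-T)..T, G (x + t * Complex.I))
      atTop (nhds (∫ t : ℝ, G (x + t * Complex.I))) := fun x hx =>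
    intervalIntegral_tendsto_integral (hint x hx) tendsto_neg_atTop_atBot tendsto_id
  have hgauss : Tendsto (fun T : ℝ => D * Real.exp (-(κ / 2) * T ^ 2) * |c' - c|)
      atTop (nhds 0) := by
    have h1 : Tendsto (fun T : ℝ => -(κ / 2) * T ^ 2) atTop atBot :=
      (tendsto_pow_atTop two_ne_zero).const_mul_atTop_of_neg (by linarith)
    simpa using ((Real.tendsto_exp_atBot.comp h1).const_mul D).mul_const |c' - c|
  have hhor : ∀ ε : ℝ, ε ^ 2 = 1 → Tendsto
      (fun T : ℝ => ∫ x in c..c', G (x + (ε * T : ℝ) * Complex.I)) atTop (nhds 0) := by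
    intro ε hε
    refine squeeze_zero_norm (fun T => ?_) hgauss
    refine intervalIntegral.norm_integral_le_of_norm_le_const fun x hx => ?_
    rw [Set.uIoc_of_le hcc] at hx
    refine (hGD x ⟨hx.1.le, hx.2⟩ _).trans_eq ?_
    rw [mul_pow, hε, one_mul]
  have hrect : ∀ T : ℝ, (∫ t in (-T)..T, G (c' + t * Complex.I)) -
      ∫ t in (-T)..T, G (c + t * Complex.I) =
        Complex.I * ((∫ x in c..c', G (x + ((-1) * T : ℝ) * Complex.I)) -
          ∫ x in c..c', G (x + (1 * T : ℝ) * Complex.I)) := fun T => by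
    have h := Complex.integral_boundary_rect_eq_zero_of_differentiableOn G
      (c + (-T : ℝ) * Complex.I) (c' + T * Complex.I) (fun s hs => by
        refine (differentiableAt_mul_exp (hd s ?_) w).differentiableWithinAt
        have := hs.1
        simpa [Set.uIcc_of_le hcc] using this)
    simp only [Complex.add_re, Complex.ofReal_re, Complex.re_ofReal_mul, Complex.I_re, mul_zero,
      add_zero, Complex.add_im, Complex.ofReal_im, Complex.im_ofReal_mul, Complex.I_im, mul_one,
      zero_add, smul_eq_mul] at h
    rw [neg_one_mul, one_mul]
    linear_combination (-Complex.I) * h + ((∫ t in (-T)..T, G (c' + t * Complex.I)) -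
      ∫ t in (-T)..T, G (c + t * Complex.I)) * Complex.I_sq
  have hlim := ((hhor (-1) (by norm_num)).sub (hhor 1 (by norm_num))).const_mul Complex.I
  rw [sub_zero, mul_zero] at hlim
  have hlim' := (hvert c' hcm').sub (hvert c hcm)
  simp only [hrect] at hlim'
  exact (sub_eq_zero.1 (tendsto_nhds_unique hlim' hlim)).symm

end VerticalIntegrals

/-- Convergence, contour-independence and analyticity of the `K`-function,
in the cases `N > 0` or (`N = 0` and `Re(α) > 0`). -/
theorem Kfun_entire (τ : ℝ) (hτ : 0 < τ) (α : ℂ) (m n : ℕ) {p q : ℕ}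
    (hm : m ≤ q) (hn : n ≤ p) (a : Fin p → ℂ) (b : Fin q → ℂ)
    (hsep : ∀ j : Fin q, ∀ k : Fin p, m ≤ (j : ℕ) → n ≤ (k : ℕ) →
      (b j).re - τ - 1 < (a k).re)
    (hcase : 0 < paramN m n p q ∨ (paramN m n p q = 0 ∧ 0 < α.re)) :
    (∀ c : ℝ, (∀ j : Fin q, m ≤ (j : ℕ) → (b j).re - τ - 1 < c) →
      (∀ k : Fin p, n ≤ (k : ℕ) → c < (a k).re) →
      ∀ w : ℂ, MeasureTheory.Integrable (fun t : ℝ =>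
        (calG m n a b (c + t * Complex.I) (τ : ℂ) *
          Complex.exp ((Real.pi : ℂ) * α / (τ : ℂ) * (c + t * Complex.I) ^ 2) *
          Complex.exp (-(2 * Real.pi * w * (c + t * Complex.I)))) * Complex.I)) ∧
    (∀ c c' : ℝ, (∀ j : Fin q, m ≤ (j : ℕ) → (b j).re - τ - 1 < c) →
      (∀ k : Fin p, n ≤ (k : ℕ) → c < (a k).re) →
      (∀ j : Fin q, m ≤ (j : ℕ) → (b j).re - τ - 1 < c') →
      (∀ k : Fin p, n ≤ (k : ℕ) → c' < (a k).re) →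
      ∀ w : ℂ, Kfun m n a b (τ : ℂ) α c w = Kfun m n a b (τ : ℂ) α c' w) ∧
    (∀ c : ℝ, (∀ j : Fin q, m ≤ (j : ℕ) → (b j).re - τ - 1 < c) →
      (∀ k : Fin p, n ≤ (k : ℕ) → c < (a k).re) →
      Differentiable ℂ (fun w : ℂ => Kfun m n a b (τ : ℂ) α c w)) := by
  have hdiff : ∀ s : ℂ, (∀ j : Fin q, m ≤ (j : ℕ) → (b j).re - τ - 1 < s.re) →
      (∀ k : Fin p, n ≤ (k : ℕ) → s.re < (a k).re) →
      DifferentiableAt ℂ (fun s => calG m n a b s τ *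
        Complex.exp ((Real.pi : ℂ) * α / τ * s ^ 2)) s := fun s hb ha =>
    (differentiableAt_calG hτ hb ha).mul (by fun_prop)
  refine ⟨fun c hb ha w => ?_, ?_, fun c hb ha => ?_⟩
  · obtain ⟨C, κ, hC, hκ, hF⟩ := exists_norm_integrand_le hτ α hm hn hb ha hcase
    exact (integrable_vertical hκ hC (fun s hs => hdiff s (hs ▸ hb) (hs ▸ ha))
      (hF c ⟨le_rfl, le_rfl⟩) w).mul_const Complex.I
  · have key : ∀ c c' : ℝ, c ≤ c' → (∀ j : Fin q, m ≤ (j : ℕ) → (b j).re - τ - 1 < c) →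
        (∀ k : Fin p, n ≤ (k : ℕ) → c' < (a k).re) →
        ∀ w : ℂ, Kfun m n a b (τ : ℂ) α c w = Kfun m n a b (τ : ℂ) α c' w := by
      intro c c' hcc hb ha w
      obtain ⟨C, κ, hC, hκ, hF⟩ := exists_norm_integrand_le hτ α hm hn hb ha hcase
      have h := integral_vertical_eq hκ hC hcc (fun s hs => hdiff s
        (fun j hj => (hb j hj).trans_le hs.1) fun k hk => hs.2.trans_lt (ha k hk)) hF w
      unfold Kfun
      rw [integral_mul_const, integral_mul_const, h]
    intro c c' hb ha hb' ha' w
    rcases le_total c c' with hcc | hcc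
    · exact key c c' hcc hb ha' w
    · exact (key c' c hcc hb' ha w).symm
  · obtain ⟨C, κ, hC, hκ, hF⟩ := exists_norm_integrand_le hτ α hm hn hb ha hcase
    simp only [Kfun, integral_mul_const]
    exact ((differentiable_integral_vertical hκ hC (fun s hs => hdiff s (hs ▸ hb) (hs ▸ ha))
      (hF c ⟨le_rfl, le_rfl⟩)).mul_const Complex.I).const_mul _
end
end

section
/- Let τ > 0, α ∈ ℂ, m ≤ q and n ≤ p nonnegative integers, a ∈ ℂ^p, b ∈ ℂ^q with λ♯ < λ♭, and suppose that either N > 0, or N = 0 and Re(α) > 0. Then for every γ ∈ ℂ and every w ∈ ℂ: K^{m,n}_{p,q}(γ+a; γ+b | e^{2πw}; τ, α) = exp((πα/τ)·γ²) · e^{−2πγw} · K^{m,n}_{p,q}(a; b | e^{2π(w − αγ/τ)}; τ, α), where γ+a := (γ+a_1,…,γ+a_p) and γ+b := (γ+b_1,…,γ+b_q); on the left-hand side the contour constant is any c′ ∈ (λ♯ + Re(γ), λ♭ + Re(γ)) and on the right-hand side any c ∈ (λ♯, λ♭). -/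
open Complex Filter MeasureTheory Set

noncomputable section

namespace BarnesK

/-- The genus-two Weierstrass factor with zero at `-l`. -/
def wFactor (l : ℝ) (z : ℂ) : ℂ :=
  (1 + z / l) * Complex.exp (-(z / l) + z ^ 2 / (2 * (l : ℂ) ^ 2))

/-- The principal logarithm of `wFactor l z`, for `z` in the slit plane. -/
def wLog (l : ℝ) (z : ℂ) : ℂ :=
  Complex.log (1 + z / l) + (-(z / l) + z ^ 2 / (2 * (l : ℂ) ^ 2))

lemma one_add_div_mem_slitPlane {l : ℝ} (hl : 0 ≤ l) {z : ℂ} (hz : z ∈ slitPlane) :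
    1 + z / l ∈ slitPlane := by
  rcases hl.eq_or_lt with rfl | hl
  · simp
  rw [mem_slitPlane_iff] at hz ⊢
  simp only [add_re, one_re, add_im, one_im, div_ofReal_re, div_ofReal_im, zero_add]
  rcases hz with h | h
  · left; positivity
  · right; exact div_ne_zero h hl.ne'

lemma exp_wLog {l : ℝ} (hl : 0 ≤ l) {z : ℂ} (hz : z ∈ slitPlane) :
    Complex.exp (wLog l z) = wFactor l z := by
  rw [wLog, Complex.exp_add, Complex.exp_log (slitPlane_ne_zero (one_add_div_mem_slitPlane hl hz)),
    wFactor]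

lemma norm_wLog_le {l : ℝ} {z : ℂ} (h : ‖z / l‖ ≤ 1 / 2) : ‖wLog l z‖ ≤ ‖z / l‖ ^ 3 := by
  have h1 := Complex.norm_log_sub_logTaylor_le 2 (z := z / l) (by linarith)
  have h2 : logTaylor 3 (z / l) = z / l - z ^ 2 / (2 * (l : ℂ) ^ 2) := by
    simp [logTaylor_succ, logTaylor_zero, div_pow]
    ring
  have h3 : wLog l z = Complex.log (1 + z / l) - logTaylor 3 (z / l) := by
    rw [h2, wLog]; ring
  rw [h3]
  refine h1.trans ?_
  have h4 : (1 - ‖z / l‖)⁻¹ ≤ 2 := by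
    rw [inv_le_comm₀ (by linarith) (by norm_num)]; linarith
  have h5 : 0 ≤ ‖z / (l : ℂ)‖ ^ 3 := by positivity
  norm_num
  norm_num at h4 h5
  nlinarith [mul_le_mul_of_nonneg_left h4 h5]

lemma wFactor_eq_exp_wLog {l : ℝ} {z : ℂ} (h : ‖z / l‖ ≤ 1 / 2) :
    wFactor l z = Complex.exp (wLog l z) := by
  have h0 : 1 + z / l ≠ 0 := by
    intro h'
    have : z / l = -1 := by linear_combination h'
    rw [this] at h; norm_num at h
  rw [wLog, Complex.exp_add, Complex.exp_log h0, wFactor]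

lemma norm_wFactor_sub_one_le {l : ℝ} {z : ℂ} (h : ‖z / l‖ ≤ 1 / 2) :
    ‖wFactor l z - 1‖ ≤ 2 * ‖z / l‖ ^ 3 := by
  have h1 := norm_wLog_le h
  have h2 : ‖z / (l : ℂ)‖ ^ 3 ≤ 1 := pow_le_one₀ (norm_nonneg _) (by linarith)
  rw [wFactor_eq_exp_wLog h]
  exact (Complex.norm_exp_sub_one_le (h1.trans h2)).trans (by linarith)

lemma hasDerivAt_wLog {l : ℝ} (hl : 0 < l) {z : ℂ} (hz : z ∈ slitPlane) :
    HasDerivAt (wLog l) (z ^ 2 / ((l : ℂ) ^ 2 * (l + z))) z := by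
  have hm := one_add_div_mem_slitPlane hl.le hz
  have hl' : (l : ℂ) ≠ 0 := by exact_mod_cast hl.ne'
  have h0 : (l : ℂ) + z ≠ 0 := by
    have := slitPlane_ne_zero hm
    contrapose! this
    field_simp
    rw [this, mul_zero]
  have h1 : HasDerivAt (fun z : ℂ => z / (l : ℂ)) (1 / l) z := (hasDerivAt_id z).div_const _
  have h2 := ((h1.const_add 1).clog hm).add
    (h1.neg.add (((hasDerivAt_id z).pow 2).div_const (2 * (l : ℂ) ^ 2)))
  refine (h2.congr_deriv ?_)
  have h3 := slitPlane_ne_zero hm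
  have h4 : 1 + z / l = (l + z) / l := by field_simp
  rw [h4]
  simp
  field_simp
  ring

/-- Real part of `wLog` on the imaginary axis. -/
lemma wLog_mul_I_re {l : ℝ} (v : ℝ) :
    (wLog l (v * I)).re = -(1 / 2) * ((v / l) ^ 2 - Real.log (1 + (v / l) ^ 2)) := by
  have e1 : (v : ℂ) * I / l = ((v / l : ℝ) : ℂ) * I := by push_cast; ring
  have e2 : ((v : ℂ) * I) ^ 2 / (2 * (l : ℂ) ^ 2) = ((-(v / l) ^ 2 / 2 : ℝ) : ℂ) := by
    push_cast
    rw [mul_pow, I_sq]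
    ring
  have e3 : ‖1 + ((v / l : ℝ) : ℂ) * I‖ = Real.sqrt (1 + (v / l) ^ 2) := by
    rw [Complex.norm_def, Complex.normSq_apply]
    simp
    ring_nf
  rw [wLog, e1, e2, add_re, add_re, Complex.log_re, e3, Real.log_sqrt (by positivity), neg_re,
    re_ofReal_mul, I_re, ofReal_re]
  ring

lemma norm_wLog_sub_le {l : ℝ} (hl : 0 < l) {R v : ℝ} (hv : 0 < |v|) (hR : 2 * R < |v|) {z : ℂ}
    (hz : ‖z - v * I‖ ≤ R) :
    ‖wLog l z - wLog l (v * I)‖ ≤ 8 * R * |v| ^ (3 / 2 : ℝ) * l ^ (-(5 / 2) : ℝ) := by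
  have hR0 : 0 ≤ R := (norm_nonneg _).trans hz
  have key : ∀ w ∈ Metric.closedBall (v * I : ℂ) R, w ∈ slitPlane ∧
      ‖w ^ 2 / ((l : ℂ) ^ 2 * (l + w))‖ ≤ 8 * |v| ^ (3 / 2 : ℝ) * l ^ (-(5 / 2) : ℝ) := by
    intro w hw
    rw [mem_closedBall_iff_norm] at hw
    have him : |w.im - v| ≤ R := by
      have := (abs_im_le_norm (w - v * I)).trans hw
      simpa using this
    have hne : w.im ≠ 0 := by
      intro h0
      rw [h0, zero_sub, abs_neg] at him
      linarith
    refine ⟨mem_slitPlane_iff.2 (Or.inr hne), ?_⟩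
    have h1 : ‖w‖ ≤ 2 * |v| := by
      have : ‖w‖ ≤ ‖w - v * I‖ + ‖(v * I : ℂ)‖ := by
        simpa using norm_add_le (w - v * I) (v * I)
      simp at this
      linarith
    have h2 : Real.sqrt (l ^ 2 + v ^ 2) / 2 ≤ ‖(l : ℂ) + w‖ := by
      have a1 : ‖(l : ℂ) + v * I‖ = Real.sqrt (l ^ 2 + v ^ 2) := by
        rw [Complex.norm_def, Complex.normSq_apply]
        simp
        ring_nf
      have a2 : ‖(l : ℂ) + v * I‖ ≤ ‖(l : ℂ) + w‖ + ‖w - v * I‖ := by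
        have e : (l : ℂ) + w - (w - v * I) = l + v * I := by ring
        exact e ▸ norm_sub_le ((l : ℂ) + w) (w - v * I)
      have a3 : |v| ≤ Real.sqrt (l ^ 2 + v ^ 2) := by
        rw [← Real.sqrt_sq_eq_abs]
        exact Real.sqrt_le_sqrt (by nlinarith)
      linarith
    have h3 : l ^ (1 / 2 : ℝ) * |v| ^ (1 / 2 : ℝ) ≤ Real.sqrt (l ^ 2 + v ^ 2) := by
      rw [← Real.mul_rpow hl.le hv.le, ← Real.sqrt_eq_rpow]
      apply Real.sqrt_le_sqrt
      nlinarith [sq_abs v, sq_nonneg (l - |v|), mul_pos hl hv]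
    have e1 : |v| ^ (3 / 2 : ℝ) = |v| ^ 2 / |v| ^ (1 / 2 : ℝ) := by
      rw [← Real.rpow_natCast, ← Real.rpow_sub hv]; norm_num
    have e2 : l ^ (-(5 / 2) : ℝ) = 1 / (l ^ 2 * l ^ (1 / 2 : ℝ)) := by
      rw [← Real.rpow_natCast, ← Real.rpow_add hl, one_div, ← Real.rpow_neg hl.le]; norm_num
    have hp1 : 0 < l ^ (1 / 2 : ℝ) := by positivity
    have hp2 : 0 < |v| ^ (1 / 2 : ℝ) := by positivity
    rw [norm_div, norm_mul, norm_pow, norm_pow, norm_real, Real.norm_of_nonneg hl.le, e1, e2]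
    calc ‖w‖ ^ 2 / (l ^ 2 * ‖(l : ℂ) + w‖)
        ≤ (2 * |v|) ^ 2 / (l ^ 2 * (l ^ (1 / 2 : ℝ) * |v| ^ (1 / 2 : ℝ) / 2)) := by
          gcongr
          linarith
      _ = _ := by field_simp; ring
  have := (convex_closedBall (v * I : ℂ) R).norm_image_sub_le_of_norm_hasDerivWithin_le
    (f := wLog l) (fun w hw => (hasDerivAt_wLog hl (key w hw).1).hasDerivWithinAt)
    (fun w hw => (key w hw).2) (Metric.mem_closedBall_self hR0)
    (mem_closedBall_iff_norm.2 hz)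
  refine this.trans ?_
  calc _ ≤ 8 * |v| ^ (3 / 2 : ℝ) * l ^ (-(5 / 2) : ℝ) * R := by gcongr
    _ = _ := by ring


section Product

variable {ι : Type*} {l : ι → ℝ}

/-- The genus-two canonical product with zeros at `-l i`. -/
def wProd (l : ι → ℝ) (z : ℂ) : ℂ := ∏' i, wFactor (l i) z

/-- The logarithm of the modulus of `wProd l` on the imaginary axis. -/
def axisLog (l : ι → ℝ) (v : ℝ) : ℝ := ∑' i, (wLog (l i) (v * I)).re

lemma eventually_norm_div_le (h0 : ∀ i, 0 ≤ l i) (h3 : Summable fun i => (l i)⁻¹ ^ 3) (R : ℝ) :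
    ∀ᶠ i in cofinite, ∀ z : ℂ, ‖z‖ ≤ R → ‖z / l i‖ ≤ 1 / 2 := by
  have hpos : (0 : ℝ) < (1 / (2 * (|R| + 1))) ^ 3 := by positivity
  filter_upwards [h3.tendsto_cofinite_zero.eventually_lt_const hpos] with i hi z hz
  have h1 : (l i)⁻¹ < 1 / (2 * (|R| + 1)) := lt_of_pow_lt_pow_left₀ 3 (by positivity) hi
  rw [norm_div, norm_real, Real.norm_of_nonneg (h0 i), div_eq_mul_inv]
  calc ‖z‖ * (l i)⁻¹ ≤ (|R| + 1) * (1 / (2 * (|R| + 1))) := by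
        have := h0 i
        gcongr
        linarith [le_abs_self R]
    _ = 1 / 2 := by field_simp

lemma norm_div_pow_three (h0 : ∀ i, 0 ≤ l i) (z : ℂ) (i : ι) :
    ‖z / l i‖ ^ 3 = ‖z‖ ^ 3 * (l i)⁻¹ ^ 3 := by
  rw [norm_div, norm_real, Real.norm_of_nonneg (h0 i), div_eq_mul_inv, mul_pow]

lemma summable_wLog (h0 : ∀ i, 0 ≤ l i) (h3 : Summable fun i => (l i)⁻¹ ^ 3) (z : ℂ) :
    Summable fun i => wLog (l i) z := by
  refine (h3.mul_left (‖z‖ ^ 3)).of_norm_bounded_eventually ?_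
  filter_upwards [eventually_norm_div_le h0 h3 ‖z‖] with i hi
  exact norm_div_pow_three h0 z i ▸ norm_wLog_le (hi z le_rfl)

lemma wProd_eq_exp (h0 : ∀ i, 0 ≤ l i) (h3 : Summable fun i => (l i)⁻¹ ^ 3) {z : ℂ}
    (hz : z ∈ slitPlane) : wProd l z = Complex.exp (∑' i, wLog (l i) z) := by
  have h := (summable_wLog h0 h3 z).hasSum.cexp
  have e : Complex.exp ∘ (fun i => wLog (l i) z) = fun i => wFactor (l i) z :=
    funext fun i => exp_wLog (h0 i) hz
  rw [e] at h
  exact h.tprod_eq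

lemma log_norm_wProd (h0 : ∀ i, 0 ≤ l i) (h3 : Summable fun i => (l i)⁻¹ ^ 3) {z : ℂ}
    (hz : z ∈ slitPlane) : Real.log ‖wProd l z‖ = ∑' i, (wLog (l i) z).re := by
  rw [wProd_eq_exp h0 h3 hz, Complex.norm_exp, Real.log_exp,
    Complex.re_tsum (summable_wLog h0 h3 z)]

lemma differentiable_wFactor (a : ℝ) : Differentiable ℂ (wFactor a) := by
  unfold wFactor
  fun_prop

lemma differentiable_wProd (h0 : ∀ i, 0 ≤ l i) (h3 : Summable fun i => (l i)⁻¹ ^ 3) :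
    Differentiable ℂ (wProd l) := by
  intro z
  have hd : DifferentiableOn ℂ (wProd l) (Metric.ball 0 (‖z‖ + 1)) := by
    have := Summable.hasProdLocallyUniformlyOn_one_add (R := ℂ) (f := fun i z => wFactor (l i) z - 1)
      (K := Metric.ball (0 : ℂ) (‖z‖ + 1)) Metric.isOpen_ball
      (h3.mul_left (2 * (‖z‖ + 1) ^ 3)) ?_
      (fun i => ((differentiable_wFactor (l i)).sub_const 1).continuous.continuousOn)
    · simp only [add_sub_cancel] at this
      refine (hasProdLocallyUniformlyOn_iff_tendstoLocallyUniformlyOn.1 this).differentiableOn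
        (Eventually.of_forall fun s => ?_) Metric.isOpen_ball
      exact (Differentiable.fun_finsetProd fun i _ => differentiable_wFactor (l i)).differentiableOn
    · filter_upwards [eventually_norm_div_le h0 h3 (‖z‖ + 1)] with i hi w hw
      have hw' : ‖w‖ ≤ ‖z‖ + 1 := by simpa using (Metric.mem_ball.1 hw).le
      refine (norm_wFactor_sub_one_le (hi w hw')).trans ?_
      rw [norm_div_pow_three h0, ← mul_assoc]
      have := h0 i
      gcongr
  exact hd.differentiableAt (Metric.isOpen_ball.mem_nhds (by simp))

lemma axisLog_neg (v : ℝ) : axisLog l (-v) = axisLog l v := by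
  unfold axisLog
  simp only [wLog_mul_I_re, neg_div, neg_sq]

lemma abs_log_norm_wProd_sub_le (h0 : ∀ i, 0 ≤ l i) (h3 : Summable fun i => (l i)⁻¹ ^ 3)
    (h52 : Summable fun i => l i ^ (-(5 / 2) : ℝ)) {R v : ℝ} (hv : 0 < |v|) (hR : 2 * R < |v|)
    {z : ℂ} (hz : ‖z - v * I‖ ≤ R) :
    |Real.log ‖wProd l z‖ - axisLog l v| ≤
      8 * R * (∑' i, l i ^ (-(5 / 2) : ℝ)) * |v| ^ (3 / 2 : ℝ) := by
  have hR0 : 0 ≤ R := (norm_nonneg _).trans hz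
  have hzs : z ∈ slitPlane := by
    refine mem_slitPlane_iff.2 (Or.inr fun h => ?_)
    have := (abs_im_le_norm (z - v * I)).trans hz
    simp [h] at this
    linarith
  have hsum (w : ℂ) : Summable fun i => (wLog (l i) w).re :=
    (Complex.hasSum_re (summable_wLog h0 h3 w).hasSum).summable
  rw [log_norm_wProd h0 h3 hzs, axisLog, ← (hsum z).tsum_sub (hsum (v * I)), ← Real.norm_eq_abs]
  have hb : HasSum (fun i => 8 * R * |v| ^ (3 / 2 : ℝ) * l i ^ (-(5 / 2) : ℝ))
      (8 * R * (∑' i, l i ^ (-(5 / 2) : ℝ)) * |v| ^ (3 / 2 : ℝ)) := by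
    rw [mul_right_comm (8 * R)]
    exact h52.hasSum.mul_left _
  refine tsum_of_norm_bounded hb fun i => ?_
  rw [← sub_re]
  refine (abs_re_le_norm _).trans ?_
  rcases (h0 i).eq_or_lt with h | h
  · have hw : ∀ w, wLog (l i) w = 0 := fun w => by simp [wLog, ← h]
    have := h0 i
    rw [hw, hw, sub_zero, norm_zero]
    positivity
  · exact norm_wLog_sub_le h hv hR hz

lemma log_one_add_le_half {x : ℝ} (hx : 4 ≤ x) : Real.log (1 + x) ≤ x / 2 := by
  have h1 := Real.log_le_sub_one_of_pos (show 0 < (1 + x) / 4 by linarith)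
  rw [Real.log_div (by linarith) (by norm_num), show (4 : ℝ) = 2 ^ 2 by norm_num, Real.log_pow] at h1
  have := Real.log_two_lt_d9
  push_cast at h1
  linarith

lemma axisLog_le (h0 : ∀ i, 0 ≤ l i) (h3 : Summable fun i => (l i)⁻¹ ^ 3)
    (h2 : ¬ Summable fun i => (l i)⁻¹ ^ 2) (M : ℝ) :
    ∃ T, ∀ v : ℝ, T ≤ |v| → axisLog l v ≤ -M * v ^ 2 := by
  obtain ⟨S, hS⟩ : ∃ S : Finset ι, 4 * M < ∑ i ∈ S, (l i)⁻¹ ^ 2 := by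
    by_contra! h
    exact h2 (summable_of_sum_le (fun i => by positivity) h)
  refine ⟨2 * ∑ i ∈ S, l i, fun v hv => ?_⟩
  have hsum : Summable fun i => (wLog (l i) (v * I)).re :=
    (Complex.hasSum_re (summable_wLog h0 h3 _).hasSum).summable
  have hterm (i : ι) : (wLog (l i) (v * I)).re ≤ 0 := by
    rw [wLog_mul_I_re]
    have := Real.log_le_sub_one_of_pos (show 0 < 1 + (v / l i) ^ 2 by positivity)
    linarith
  have h4 : axisLog l v ≤ ∑ i ∈ S, (wLog (l i) (v * I)).re := by
    have := hsum.neg.sum_le_tsum S (fun i _ => neg_nonneg.2 (hterm i))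
    rw [tsum_neg, Finset.sum_neg_distrib] at this
    exact neg_le_neg_iff.1 this
  have h5 : ∀ i ∈ S, (wLog (l i) (v * I)).re ≤ -(1 / 4) * v ^ 2 * (l i)⁻¹ ^ 2 := by
    intro i hi
    have e : v ^ 2 * (l i)⁻¹ ^ 2 = (v / l i) ^ 2 := by rw [div_eq_mul_inv, mul_pow]
    rw [wLog_mul_I_re, mul_assoc, e]
    rcases (h0 i).eq_or_lt with h | h
    · simp [← h]
    · have h6 : 2 * l i ≤ |v| := by
        have := Finset.single_le_sum (fun i _ => h0 i) hi
        linarith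
      have h7 : 4 ≤ (v / l i) ^ 2 := by
        rw [div_pow, le_div_iff₀ (by positivity), ← sq_abs v]
        nlinarith
      linarith [log_one_add_le_half h7]
  refine h4.trans ((Finset.sum_le_sum h5).trans ?_)
  rw [← Finset.mul_sum]
  nlinarith [sq_nonneg v]

end Product

section Lattice

/-- The points `mτ + n` of the quarter lattice. -/
def quarterLattice (τ : ℝ) (x : ℕ × ℕ) : ℝ := x.1 * τ + x.2

variable {τ : ℝ}

lemma quarterLattice_nonneg (hτ : 0 < τ) (x : ℕ × ℕ) : 0 ≤ quarterLattice τ x := by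
  unfold quarterLattice; positivity

lemma summable_quarterLattice_rpow (hτ : 0 < τ) {k : ℝ} (hk : 2 < k) :
    Summable fun x => quarterLattice τ x ^ (-k) := by
  have hinj : Function.Injective fun x : ℕ × ℕ => ![(x.1 : ℤ), (x.2 : ℤ)] := by
    rintro ⟨a, b⟩ ⟨c, d⟩ h
    have h1 := congrFun h 0
    have h2 := congrFun h 1
    simp at h1 h2
    simp [h1, h2]
  have hs := (EisensteinSeries.summable_one_div_norm_rpow hk).comp_injective hinj
  have hc : 0 < min τ 1 := lt_min hτ one_pos
  refine (hs.mul_left (min τ 1 ^ (-k))).of_nonneg_of_le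
    (fun x => Real.rpow_nonneg (quarterLattice_nonneg hτ x) _) fun x => ?_
  have hn : ‖![(x.1 : ℤ), (x.2 : ℤ)]‖ = max (x.1 : ℝ) x.2 := by
    rw [EisensteinSeries.norm_eq_max_natAbs]
    simp
  simp only [Function.comp_apply, hn]
  rw [← Real.mul_rpow hc.le (by positivity)]
  rcases eq_or_ne x (0, 0) with rfl | hx
  · simp [quarterLattice]
  have hmax : 0 < max (x.1 : ℝ) x.2 := by
    rw [lt_max_iff]
    norm_cast
    by_contra! h
    exact hx (Prod.ext (by simpa using h.1) (by simpa using h.2))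
  refine Real.rpow_le_rpow_of_nonpos (by positivity) ?_ (by linarith)
  have h1 : min τ 1 * (x.1 : ℝ) ≤ x.1 * τ := by
    rw [mul_comm]; gcongr; exact min_le_left _ _
  have h2 : min τ 1 * (x.2 : ℝ) ≤ x.2 :=
    mul_le_of_le_one_left (by positivity) (min_le_right _ _)
  unfold quarterLattice
  rcases max_cases (x.1 : ℝ) x.2 with ⟨h, -⟩ | ⟨h, -⟩ <;> rw [h]
  · exact h1.trans (by simp)
  · exact h2.trans (by simp; positivity)

lemma summable_quarterLattice_inv_cube (hτ : 0 < τ) :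
    Summable fun x => (quarterLattice τ x)⁻¹ ^ 3 := by
  refine (summable_quarterLattice_rpow hτ (k := (3 : ℕ)) (by norm_num)).congr fun x => ?_
  rw [Real.rpow_neg (quarterLattice_nonneg hτ x), Real.rpow_natCast, inv_pow]

lemma not_summable_quarterLattice_inv_sq (hτ : 0 < τ) :
    ¬ Summable fun x => (quarterLattice τ x)⁻¹ ^ 2 := by
  intro h
  have hp := (summable_prod_of_nonneg fun x => by positivity).1 h
  refine Real.not_summable_one_div_natCast
    ((hp.2.mul_left ((τ + 1) ^ 2)).of_nonneg_of_le (fun _ => by positivity) fun k => ?_)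
  rcases Nat.eq_zero_or_pos k with rfl | hk
  · simp only [CharP.cast_eq_zero, div_zero]
    have : 0 ≤ ∑' y, (quarterLattice τ (0, y))⁻¹ ^ 2 := tsum_nonneg fun y => by positivity
    positivity
  have hk' : (0 : ℝ) < k := by exact_mod_cast hk
  have h1 : ∑ y ∈ Finset.range k, (quarterLattice τ (k, y))⁻¹ ^ 2 ≤
      ∑' y, (quarterLattice τ (k, y))⁻¹ ^ 2 :=
    (hp.1 k).sum_le_tsum _ fun y _ => by positivity
  have h2 : ∑ _y ∈ Finset.range k, ((k : ℝ) * (τ + 1))⁻¹ ^ 2 ≤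
      ∑ y ∈ Finset.range k, (quarterLattice τ (k, y))⁻¹ ^ 2 := by
    refine Finset.sum_le_sum fun y hy => ?_
    have hy' : (y : ℝ) ≤ k := by exact_mod_cast (Finset.mem_range.1 hy).le
    have h3 : 0 < quarterLattice τ (k, y) := by unfold quarterLattice; positivity
    gcongr
    unfold quarterLattice
    linarith
  rw [Finset.sum_const, Finset.card_range, nsmul_eq_mul] at h2
  calc 1 / (k : ℝ) = (τ + 1) ^ 2 * (k * ((k : ℝ) * (τ + 1))⁻¹ ^ 2) := by field_simp
    _ ≤ _ := by gcongr; exact h2.trans h1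

lemma barnesG_eq (z : ℂ) (τ : ℝ) :
    barnesG z τ = z / τ * Complex.exp (aBarnes τ * z / τ + bBarnes τ * z ^ 2 / (2 * τ)) *
      wProd (quarterLattice τ) z := by
  unfold barnesG wProd
  congr 2
  ext x
  split_ifs with h
  · simp [h, quarterLattice, wFactor]
  · simp [quarterLattice, wFactor]

lemma differentiable_barnesG (hτ : 0 < τ) : Differentiable ℂ fun z => barnesG z τ := by
  simp only [barnesG_eq]
  have := differentiable_wProd (quarterLattice_nonneg hτ) (summable_quarterLattice_inv_cube hτ)
  fun_prop

lemma barnesG_ne_zero (hτ : 0 < τ) {z : ℂ} (hz : z ∈ slitPlane) : barnesG z τ ≠ 0 := by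
  rw [barnesG_eq,
    wProd_eq_exp (quarterLattice_nonneg hτ) (summable_quarterLattice_inv_cube hτ) hz]
  have := slitPlane_ne_zero hz
  have : (τ : ℂ) ≠ 0 := by exact_mod_cast hτ.ne'
  simp [*]

end Lattice

section Growth

open Asymptotics

/-- The filter of points escaping to `±i∞` inside the vertical strip `c₁ ≤ re s ≤ c₂`. -/
def stripEnds (c₁ c₂ : ℝ) : Filter ℂ :=
  comap (fun s : ℂ => |s.im|) atTop ⊓ 𝓟 {s | s.re ∈ Icc c₁ c₂}

variable {τ c₁ c₂ : ℝ}

lemma tendsto_abs_im_stripEnds : Tendsto (fun s : ℂ => |s.im|) (stripEnds c₁ c₂) atTop :=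
  tendsto_comap.mono_left inf_le_left

lemma eventually_re_mem_stripEnds : ∀ᶠ s in stripEnds c₁ c₂, s.re ∈ Icc c₁ c₂ :=
  mem_inf_of_right (mem_principal_self _)

lemma isLittleO_abs_rpow_three_halves :
    (fun s : ℂ => |s.im| ^ (3 / 2 : ℝ)) =o[stripEnds c₁ c₂] fun s => s.im ^ 2 := by
  have h : (fun x : ℝ => x ^ (3 / 2 : ℝ)) =o[atTop] fun x => x ^ (2 : ℝ) := by
    refine (isLittleO_iff_tendsto' ?_).2
      ((tendsto_rpow_neg_atTop (y := 1 / 2) (by norm_num)).congr' ?_)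
    · filter_upwards [eventually_gt_atTop 0] with x hx h
      exact absurd h (Real.rpow_pos_of_pos hx _).ne'
    · filter_upwards [eventually_gt_atTop 0] with x hx
      rw [← Real.rpow_sub hx]
      norm_num
  refine (h.comp_tendsto (tendsto_abs_im_stripEnds (c₁ := c₁) (c₂ := c₂))).congr_right fun s => ?_
  simp

/-- The leading part of `log |G(iy; τ)|` as `y → ±∞`. -/
def barnesLeading (τ y : ℝ) : ℝ :=
  axisLog (quarterLattice τ) y - (bBarnes τ / (2 * τ)).re * y ^ 2

lemma barnesLeading_neg (y : ℝ) : barnesLeading τ (-y) = barnesLeading τ y := by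
  simp [barnesLeading, axisLog_neg]

lemma eventually_barnesLeading_le (hτ : 0 < τ) (M : ℝ) :
    ∀ᶠ s in stripEnds c₁ c₂, barnesLeading τ s.im ≤ -M * s.im ^ 2 := by
  obtain ⟨T, hT⟩ := axisLog_le (quarterLattice_nonneg hτ) (summable_quarterLattice_inv_cube hτ)
    (not_summable_quarterLattice_inv_sq hτ) (M - (bBarnes τ / (2 * τ)).re)
  filter_upwards [tendsto_abs_im_stripEnds.eventually_ge_atTop T] with s hs
  have := hT _ hs
  rw [barnesLeading]
  linarith

/-- `|f|` grows like the `k`-th power of `|G(iy; τ)|` at the ends of a strip, up to `exp (o(y²))`. -/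
def HasBarnesOrder (τ c₁ c₂ k : ℝ) (f : ℂ → ℂ) : Prop :=
  (∀ᶠ s in stripEnds c₁ c₂, f s ≠ 0) ∧
    (fun s => Real.log ‖f s‖ - k * barnesLeading τ s.im) =o[stripEnds c₁ c₂] fun s => s.im ^ 2

namespace HasBarnesOrder

variable {k k' : ℝ} {f g : ℂ → ℂ}

lemma one : HasBarnesOrder τ c₁ c₂ 0 fun _ => 1 :=
  ⟨by simp, by simp⟩

lemma mul (hf : HasBarnesOrder τ c₁ c₂ k f) (hg : HasBarnesOrder τ c₁ c₂ k' g) :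
    HasBarnesOrder τ c₁ c₂ (k + k') fun s => f s * g s := by
  refine ⟨by filter_upwards [hf.1, hg.1] with s h h' using mul_ne_zero h h',
    (hf.2.add hg.2).congr' ?_ EventuallyEq.rfl⟩
  filter_upwards [hf.1, hg.1] with s h h'
  rw [norm_mul, Real.log_mul (norm_ne_zero_iff.2 h) (norm_ne_zero_iff.2 h')]
  ring

lemma div (hf : HasBarnesOrder τ c₁ c₂ k f) (hg : HasBarnesOrder τ c₁ c₂ k' g) :
    HasBarnesOrder τ c₁ c₂ (k - k') fun s => f s / g s := by
  refine ⟨by filter_upwards [hf.1, hg.1] with s h h' using div_ne_zero h h',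
    (hf.2.sub hg.2).congr' ?_ EventuallyEq.rfl⟩
  filter_upwards [hf.1, hg.1] with s h h'
  rw [norm_div, Real.log_div (norm_ne_zero_iff.2 h) (norm_ne_zero_iff.2 h')]
  ring

lemma prod {ι : Type*} (S : Finset ι) {k : ι → ℝ} {f : ι → ℂ → ℂ}
    (h : ∀ i ∈ S, HasBarnesOrder τ c₁ c₂ (k i) (f i)) :
    HasBarnesOrder τ c₁ c₂ (∑ i ∈ S, k i) fun s => ∏ i ∈ S, f i s := by
  classical
  induction S using Finset.induction_on with
  | empty => simpa using one
  | insert i S hi ih =>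
    simp only [Finset.sum_insert hi, Finset.prod_insert hi]
    exact (h i (Finset.mem_insert_self _ _)).mul
      (ih fun j hj => h j (Finset.mem_insert_of_mem hj))

lemma prod_ite {ι : Type*} [Fintype ι] (P : ι → Prop) [DecidablePred P] {f : ι → ℂ → ℂ}
    (h : ∀ i, HasBarnesOrder τ c₁ c₂ 1 (f i)) :
    HasBarnesOrder τ c₁ c₂ (Fintype.card {i // P i}) fun s => ∏ i, if P i then f i s else 1 := by
  have := prod (τ := τ) (c₁ := c₁) (c₂ := c₂) Finset.univ (k := fun i => if P i then 1 else 0)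
    (f := fun i s => if P i then f i s else 1) fun i _ => by
      split_ifs
      exacts [h i, one]
  simpa [Fintype.card_subtype] using this

end HasBarnesOrder

lemma abs_log_norm_barnesG_sub_le (hτ : 0 < τ) {R : ℝ} (hR : 0 ≤ R) :
    ∃ K, ∀ v : ℝ, 2 * R + 1 < |v| → ∀ z : ℂ, ‖z - v * I‖ ≤ R →
      |Real.log ‖barnesG z τ‖ - barnesLeading τ v| ≤ K * |v| ^ (3 / 2 : ℝ) := by
  set A : ℂ := aBarnes τ / τ with hA
  set B : ℂ := bBarnes τ / (2 * τ) with hB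
  set S := ∑' x, quarterLattice τ x ^ (-(5 / 2) : ℝ)
  refine ⟨2 + |Real.log τ| + 2 * ‖A‖ + 3 * R * ‖B‖ + 8 * R * S, fun v hv z hz => ?_⟩
  have hv1 : 1 ≤ |v| := by linarith
  have hvI : ‖(v * I : ℂ)‖ = |v| := by simp
  have hz1 : 1 ≤ ‖z‖ := by
    have := norm_sub_norm_le (v * I : ℂ) z
    rw [norm_sub_rev, hvI] at this
    linarith
  have hz2 : ‖z‖ ≤ 2 * |v| := by
    have := norm_add_le (z - v * I) (v * I)
    rw [sub_add_cancel, hvI] at this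
    linarith
  have hzs : z ∈ slitPlane := by
    refine mem_slitPlane_iff.2 (Or.inr fun h => ?_)
    have := (abs_im_le_norm (z - v * I)).trans hz
    simp [h] at this
    linarith
  have hP := abs_log_norm_wProd_sub_le (quarterLattice_nonneg hτ)
    (summable_quarterLattice_inv_cube hτ) (summable_quarterLattice_rpow hτ (by norm_num))
    (by linarith) (by linarith) hz
  have hP0 : wProd (quarterLattice τ) z ≠ 0 := by
    rw [wProd_eq_exp (quarterLattice_nonneg hτ) (summable_quarterLattice_inv_cube hτ) hzs]
    exact Complex.exp_ne_zero _
  have hlog : Real.log ‖barnesG z τ‖ = Real.log ‖z‖ - Real.log τ + (A * z).re +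
      (B * z ^ 2).re + Real.log ‖wProd (quarterLattice τ) z‖ := by
    rw [barnesG_eq, norm_mul, norm_mul, norm_div, norm_real, Real.norm_of_nonneg hτ.le,
      Real.log_mul (mul_ne_zero (by positivity) (norm_ne_zero_iff.2 (Complex.exp_ne_zero _)))
        (norm_ne_zero_iff.2 hP0),
      Real.log_mul (by positivity) (norm_ne_zero_iff.2 (Complex.exp_ne_zero _)),
      Real.log_div (by positivity) hτ.ne', Complex.norm_exp, Real.log_exp, add_re, hA, hB]
    ring_nf
  have h1 : |Real.log ‖z‖| ≤ 2 * |v| := by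
    rw [abs_of_nonneg (Real.log_nonneg hz1)]
    linarith [Real.log_le_sub_one_of_pos (show 0 < ‖z‖ by linarith)]
  have h2 : |(A * z).re| ≤ ‖A‖ * (2 * |v|) :=
    (abs_re_le_norm _).trans (by rw [norm_mul]; gcongr)
  have h3 : |(B * z ^ 2).re + B.re * v ^ 2| ≤ ‖B‖ * (3 * R * |v|) := by
    have e : (B * z ^ 2).re + B.re * v ^ 2 = (B * ((z - v * I) * (z + v * I))).re := by
      have : B * ((z - v * I) * (z + v * I)) = B * z ^ 2 + B * ((v ^ 2 : ℝ) : ℂ) := by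
        push_cast
        linear_combination (-(B * v ^ 2)) * I_sq
      rw [this, add_re, re_mul_ofReal]
    rw [e]
    refine (abs_re_le_norm _).trans ?_
    rw [norm_mul, norm_mul, mul_assoc 3, mul_left_comm 3]
    have : ‖z + v * I‖ ≤ 3 * |v| := (norm_add_le _ _).trans (by rw [hvI]; linarith)
    gcongr
  have h4 : |v| ≤ |v| ^ (3 / 2 : ℝ) := by
    conv_lhs => rw [← Real.rpow_one |v|]
    exact Real.rpow_le_rpow_of_exponent_le hv1 (by norm_num)
  have h5 : |Real.log ‖barnesG z τ‖ - barnesLeading τ v| ≤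
      2 * |v| + |Real.log τ| * |v| + ‖A‖ * (2 * |v|) + ‖B‖ * (3 * R * |v|) +
        8 * R * S * |v| ^ (3 / 2 : ℝ) := by
    have h6 : |Real.log τ| ≤ |Real.log τ| * |v| := le_mul_of_one_le_right (abs_nonneg _) hv1
    rw [hlog, barnesLeading]
    rw [abs_le] at *
    have h7 := neg_abs_le (Real.log τ)
    have h8 := le_abs_self (Real.log τ)
    constructor <;> linarith
  refine h5.trans ?_
  have h9 : (2 + |Real.log τ| + 2 * ‖A‖ + 3 * R * ‖B‖) * |v| ≤
      (2 + |Real.log τ| + 2 * ‖A‖ + 3 * R * ‖B‖) * |v| ^ (3 / 2 : ℝ) := by gcongr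
  linarith

lemma hasBarnesOrder_barnesG (hτ : 0 < τ) {g : ℂ → ℂ} {R : ℝ}
    (hg : (∀ s : ℂ, s.re ∈ Icc c₁ c₂ → ‖g s - s.im * I‖ ≤ R) ∨
      ∀ s : ℂ, s.re ∈ Icc c₁ c₂ → ‖g s - (-s.im : ℝ) * I‖ ≤ R) :
    HasBarnesOrder τ c₁ c₂ 1 fun s => barnesG (g s) τ := by
  have hR : R ≤ |R| := le_abs_self R
  have hg' : ∀ s : ℂ, s.re ∈ Icc c₁ c₂ → ∃ v : ℝ, |v| = |s.im| ∧
      barnesLeading τ v = barnesLeading τ s.im ∧ ‖g s - v * I‖ ≤ |R| := by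
    intro s hs
    rcases hg with h | h
    · exact ⟨s.im, rfl, rfl, (h s hs).trans hR⟩
    · exact ⟨-s.im, abs_neg _, barnesLeading_neg _, (h s hs).trans hR⟩
  obtain ⟨K, hK⟩ := abs_log_norm_barnesG_sub_le hτ (abs_nonneg R)
  have hev := (tendsto_abs_im_stripEnds (c₁ := c₁) (c₂ := c₂)).eventually_gt_atTop (2 * |R| + 1)
  constructor
  · filter_upwards [hev, eventually_re_mem_stripEnds] with s h1 h2
    obtain ⟨v, hv1, -, hv3⟩ := hg' s h2
    refine barnesG_ne_zero hτ (mem_slitPlane_iff.2 (Or.inr fun h => ?_))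
    have := (abs_im_le_norm (g s - v * I)).trans hv3
    simp [h] at this
    linarith [abs_nonneg R]
  · refine IsBigO.trans_isLittleO (IsBigO.of_bound K ?_) isLittleO_abs_rpow_three_halves
    filter_upwards [hev, eventually_re_mem_stripEnds] with s h1 h2
    obtain ⟨v, hv1, hv2, hv3⟩ := hg' s h2
    have := hK v (hv1 ▸ h1) _ hv3
    rw [hv1, hv2] at this
    rw [one_mul, Real.norm_eq_abs, Real.norm_of_nonneg (by positivity)]
    exact this

lemma hasBarnesOrder_barnesG_add (hτ : 0 < τ) (d : ℂ) :
    HasBarnesOrder τ c₁ c₂ 1 fun s => barnesG (d + s) τ := by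
  refine hasBarnesOrder_barnesG hτ (R := ‖d‖ + max |c₁| |c₂|) (Or.inl fun s hs => ?_)
  have e : d + s - s.im * I = d + (s.re : ℂ) := by
    apply Complex.ext <;> simp
  rw [e]
  refine (norm_add_le _ _).trans ?_
  rw [norm_real]
  gcongr
  exact abs_le_max_abs_abs hs.1 hs.2

lemma hasBarnesOrder_barnesG_sub (hτ : 0 < τ) (d : ℂ) :
    HasBarnesOrder τ c₁ c₂ 1 fun s => barnesG (d - s) τ := by
  refine hasBarnesOrder_barnesG hτ (R := ‖d‖ + max |c₁| |c₂|) (Or.inr fun s hs => ?_)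
  have e : d - s - (-s.im : ℝ) * I = d - (s.re : ℂ) := by
    apply Complex.ext <;> simp
  rw [e]
  refine (norm_sub_le _ _).trans ?_
  rw [norm_real]
  gcongr
  exact abs_le_max_abs_abs hs.1 hs.2

lemma hasBarnesOrder_calG (hτ : 0 < τ) {m n p q : ℕ} (hm : m ≤ q) (hn : n ≤ p)
    (a : Fin p → ℂ) (b : Fin q → ℂ) :
    HasBarnesOrder τ c₁ c₂ (paramN m n p q) fun s => calG m n a b s τ := by
  have h1 {k N : ℕ} (hk : k ≤ N) : Fintype.card {j : Fin N // (j : ℕ) < k} = k := by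
    rw [Fintype.card_subtype, Fin.card_filter_val_lt, min_eq_right hk]
  have h2 {k N : ℕ} (hk : k ≤ N) : Fintype.card {j : Fin N // k ≤ (j : ℕ)} = N - k := by
    simp_rw [← not_lt]
    rw [Fintype.card_subtype_compl, h1 hk, Fintype.card_fin]
  have h := ((HasBarnesOrder.prod_ite (τ := τ) (c₁ := c₁) (c₂ := c₂)
      (fun j : Fin q => (j : ℕ) < m) fun j => hasBarnesOrder_barnesG_sub hτ (b j)).mul
    (HasBarnesOrder.prod_ite (fun j : Fin p => (j : ℕ) < n) fun j =>
      hasBarnesOrder_barnesG_add hτ (1 + τ - a j))).div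
    ((HasBarnesOrder.prod_ite (fun j : Fin q => m ≤ (j : ℕ)) fun j =>
      hasBarnesOrder_barnesG_add hτ (1 + τ - b j)).mul
    (HasBarnesOrder.prod_ite (fun j : Fin p => n ≤ (j : ℕ)) fun j =>
      hasBarnesOrder_barnesG_sub hτ (a j)))
  rw [h1 hm, h1 hn, h2 hm, h2 hn] at h
  convert! h using 1
  rw [paramN, Nat.cast_sub hm, Nat.cast_sub hn]
  push_cast
  ring

lemma isLittleO_quadratic_re (A B : ℂ) :
    (fun s : ℂ => (A * s ^ 2 + B * s).re + A.re * s.im ^ 2) =o[stripEnds c₁ c₂]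
      fun s => s.im ^ 2 := by
  set c := max |c₁| |c₂|
  refine IsBigO.trans_isLittleO (IsBigO.of_bound (‖A‖ * (c ^ 2 + 2 * c) + ‖B‖ * (c + 1)) ?_)
    isLittleO_abs_rpow_three_halves
  filter_upwards [tendsto_abs_im_stripEnds.eventually_ge_atTop 1, eventually_re_mem_stripEnds]
    with s h1 h2
  have hx : |s.re| ≤ c := abs_le_max_abs_abs h2.1 h2.2
  have hc : 0 ≤ c := (abs_nonneg _).trans hx
  have e : (A * s ^ 2 + B * s).re + A.re * s.im ^ 2 =
      (A * ((s.re : ℂ) * (s.re + 2 * s.im * I)) + B * (s.re + s.im * I)).re := by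
    simp [sq]
    ring
  have h3 : ‖(s.re : ℂ) + 2 * s.im * I‖ ≤ c + 2 * |s.im| :=
    (norm_add_le _ _).trans (by simpa using hx)
  have h4 : ‖(s.re : ℂ) + s.im * I‖ ≤ c + |s.im| :=
    (norm_add_le _ _).trans (by simpa using hx)
  have h5 : |s.im| ≤ |s.im| ^ (3 / 2 : ℝ) := by
    conv_lhs => rw [← Real.rpow_one |s.im|]
    exact Real.rpow_le_rpow_of_exponent_le h1 (by norm_num)
  rw [e, Real.norm_eq_abs, Real.norm_of_nonneg (by positivity)]
  calc _ ≤ ‖A‖ * (|s.re| * ‖(s.re : ℂ) + 2 * s.im * I‖) + ‖B‖ * ‖(s.re : ℂ) + s.im * I‖ := by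
        refine (abs_re_le_norm _).trans ((norm_add_le _ _).trans (le_of_eq ?_))
        rw [norm_mul, norm_mul, norm_mul, norm_real, Real.norm_eq_abs]
    _ ≤ ‖A‖ * (c * (c + 2 * |s.im|)) + ‖B‖ * (c + |s.im|) := by gcongr
    _ ≤ ‖A‖ * (c * (c * |s.im| + 2 * |s.im|)) + ‖B‖ * (c * |s.im| + |s.im|) := by
        have : c ≤ c * |s.im| := le_mul_of_one_le_right hc h1
        gcongr
    _ = (‖A‖ * (c ^ 2 + 2 * c) + ‖B‖ * (c + 1)) * |s.im| := by ring
    _ ≤ _ := by gcongr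

lemma eventually_norm_integrand_le (hτ : 0 < τ) {m n p q : ℕ} (hm : m ≤ q) (hn : n ≤ p)
    (a : Fin p → ℂ) (b : Fin q → ℂ) {A : ℂ} (B : ℂ)
    (hcase : 0 < paramN m n p q ∨ (paramN m n p q = 0 ∧ 0 < A.re)) :
    ∃ δ > 0, ∀ᶠ s in stripEnds c₁ c₂,
      ‖calG m n a b s τ * Complex.exp (A * s ^ 2 + B * s)‖ ≤ Real.exp (-δ * s.im ^ 2) := by
  obtain ⟨hne, ho⟩ := hasBarnesOrder_calG (c₁ := c₁) (c₂ := c₂) hτ hm hn a b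
  set δ : ℝ := if 0 < A.re then A.re / 2 else 1 with hδ
  have hδ0 : 0 < δ := by rw [hδ]; split_ifs <;> linarith
  have hlead : ∀ᶠ s in stripEnds c₁ c₂,
      (paramN m n p q : ℝ) * barnesLeading τ s.im - A.re * s.im ^ 2 ≤ -(2 * δ) * s.im ^ 2 := by
    rcases hcase with hN | ⟨hN, hA⟩
    · have hN' : (1 : ℝ) ≤ paramN m n p q := by exact_mod_cast hN
      filter_upwards [eventually_barnesLeading_le hτ (|A.re| + 2 * δ)] with s hs
      have hneg : -(|A.re| + 2 * δ) * s.im ^ 2 ≤ 0 :=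
        mul_nonpos_of_nonpos_of_nonneg (by linarith [abs_nonneg A.re]) (sq_nonneg _)
      have h1 : (paramN m n p q : ℝ) * barnesLeading τ s.im ≤ 1 * barnesLeading τ s.im :=
        mul_le_mul_of_nonpos_right hN' (hs.trans hneg)
      have h2 : -A.re * s.im ^ 2 ≤ |A.re| * s.im ^ 2 := by
        gcongr
        exact neg_le_abs _
      linarith
    · refine Eventually.of_forall fun s => ?_
      rw [hN, hδ, if_pos hA]
      exact le_of_eq (by push_cast; ring)
  refine ⟨δ, hδ0, ?_⟩
  filter_upwards [hne, hlead, (ho.add (isLittleO_quadratic_re A B)).bound hδ0] with s h1 h2 h3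
  rw [norm_mul, Complex.norm_exp, ← Real.exp_log (norm_pos_iff.2 h1), ← Real.exp_add]
  refine Real.exp_le_exp.2 ?_
  rw [Real.norm_eq_abs, Real.norm_of_nonneg (sq_nonneg _)] at h3
  have := le_of_abs_le h3
  linarith

end Growth

section Contour

lemma integrable_vertical_of_decay {F : ℂ → ℂ} {c₁ c₂ c δ : ℝ} (hc : c ∈ Icc c₁ c₂) (hδ : 0 < δ)
    (hF : ∀ s : ℂ, s.re ∈ Icc c₁ c₂ → DifferentiableAt ℂ F s)
    (hdec : ∀ᶠ s in stripEnds c₁ c₂, ‖F s‖ ≤ Real.exp (-δ * s.im ^ 2)) :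
    Integrable fun t : ℝ => F (c + t * I) := by
  have hcont : Continuous fun t : ℝ => F (c + t * I) := by
    refine continuous_iff_continuousAt.2 fun t => ?_
    exact (hF (c + t * I) (by simpa using hc)).continuousAt.comp
      (f := fun t : ℝ => (c + t * I : ℂ)) (by fun_prop)
  refine hcont.locallyIntegrable.integrable_of_isBigO_cocompact (g := fun t => Real.exp (-δ * t ^ 2))
    (Asymptotics.IsBigO.of_bound 1 ?_) ((integrable_exp_neg_mul_sq hδ).integrableAtFilter _)
  have ht : Tendsto (fun t : ℝ => (c + t * I : ℂ)) (cocompact ℝ) (stripEnds c₁ c₂) := by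
    refine tendsto_inf.2 ⟨tendsto_comap_iff.2 ?_, tendsto_principal.2 ?_⟩
    · have h : (fun s : ℂ => |s.im|) ∘ (fun t : ℝ => (c + t * I : ℂ)) = norm := by
        ext t
        simp [Real.norm_eq_abs]
      rw [h]
      exact tendsto_norm_cocompact_atTop
    · exact Eventually.of_forall fun t => by simpa using hc
  filter_upwards [ht.eventually hdec] with t h
  simpa using h

lemma integral_vertical_eq_of_decay_of_le {F : ℂ → ℂ} {c₁ c₂ δ : ℝ} (hc : c₁ ≤ c₂) (hδ : 0 < δ)
    (hF : ∀ s : ℂ, s.re ∈ Icc c₁ c₂ → DifferentiableAt ℂ F s)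
    (hdec : ∀ᶠ s in stripEnds c₁ c₂, ‖F s‖ ≤ Real.exp (-δ * s.im ^ 2)) :
    ∫ t : ℝ, F (c₁ + t * I) = ∫ t : ℝ, F (c₂ + t * I) := by
  have h1 := intervalIntegral_tendsto_integral
    (integrable_vertical_of_decay (left_mem_Icc.2 hc) hδ hF hdec) tendsto_neg_atTop_atBot tendsto_id
  have h2 := intervalIntegral_tendsto_integral
    (integrable_vertical_of_decay (right_mem_Icc.2 hc) hδ hF hdec)
    tendsto_neg_atTop_atBot tendsto_id
  have hside (σ : ℝ) (hσ : |σ| = 1) :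
      Tendsto (fun T : ℝ => ∫ x : ℝ in c₁..c₂, F (x + (σ * T : ℝ) * I)) atTop (nhds 0) := by
    have hlim : Tendsto (fun T : ℝ => Real.exp (-δ * T ^ 2) * |c₂ - c₁|) atTop (nhds 0) := by
      rw [← zero_mul |c₂ - c₁|]
      refine (Real.tendsto_exp_atBot.comp ?_).mul_const _
      exact (tendsto_pow_atTop two_ne_zero).const_mul_atTop_of_neg (by linarith)
    refine squeeze_zero_norm' ?_ hlim
    rw [stripEnds, eventually_inf_principal, eventually_comap] at hdec
    filter_upwards [hdec, eventually_ge_atTop 0] with T hT hT0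
    refine intervalIntegral.norm_integral_le_of_norm_le_const fun x hx => ?_
    rw [uIoc_of_le hc] at hx
    have := hT (x + (σ * T : ℝ) * I) (by simp [abs_mul, hσ, abs_of_nonneg hT0])
      (by simpa using ⟨hx.1.le, hx.2⟩)
    have hσ2 : σ ^ 2 = 1 := by rw [← sq_abs, hσ, one_pow]
    simpa [mul_pow, hσ2] using this
  have hrect (T : ℝ) : (∫ t : ℝ in -T..T, F (c₂ + t * I)) - ∫ t : ℝ in -T..T, F (c₁ + t * I) =
      I * ((∫ x : ℝ in c₁..c₂, F (x + ((-1 : ℝ) * T : ℝ) * I)) -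
        ∫ x : ℝ in c₁..c₂, F (x + ((1 : ℝ) * T : ℝ) * I)) := by
    have := integral_boundary_rect_eq_zero_of_differentiableOn F ⟨c₁, -T⟩ ⟨c₂, T⟩ fun s hs =>
      (hF s (by simpa [uIcc_of_le hc] using hs.1)).differentiableWithinAt
    simp only [smul_eq_mul] at this
    rw [neg_one_mul, one_mul]
    linear_combination (-I) * this + ((∫ t : ℝ in -T..T, F (c₂ + t * I)) -
      ∫ t : ℝ in -T..T, F (c₁ + t * I)) * I_sq
  have h3 := ((hside (-1) (by simp)).sub (hside 1 (by simp))).const_mul I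
  simp only [← hrect, sub_zero, mul_zero] at h3
  exact (sub_eq_zero.1 (tendsto_nhds_unique (h2.sub h1) h3)).symm

variable {τ : ℝ} {m n p q : ℕ} {a : Fin p → ℂ} {b : Fin q → ℂ}

lemma differentiableAt_calG (hτ : 0 < τ) {s : ℂ}
    (h1 : ∀ j : Fin q, m ≤ (j : ℕ) → (b j).re - τ - 1 < s.re)
    (h2 : ∀ k : Fin p, n ≤ (k : ℕ) → s.re < (a k).re) :
    DifferentiableAt ℂ (fun s => calG m n a b s τ) s := by
  have hG := differentiable_barnesG hτ
  have hcomp {g : ℂ → ℂ} (hg : DifferentiableAt ℂ g s) :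
      DifferentiableAt ℂ (fun s => barnesG (g s) τ) s := (hG (g s)).comp s hg
  unfold calG
  refine DifferentiableAt.div (.mul ?_ ?_) (.mul ?_ ?_) (mul_ne_zero ?_ ?_)
  · refine DifferentiableAt.fun_finsetProd fun j _ => ?_
    split_ifs
    exacts [hcomp (by fun_prop), differentiableAt_const _]
  · refine DifferentiableAt.fun_finsetProd fun j _ => ?_
    split_ifs
    exacts [hcomp (by fun_prop), differentiableAt_const _]
  · refine DifferentiableAt.fun_finsetProd fun j _ => ?_
    split_ifs
    exacts [hcomp (by fun_prop), differentiableAt_const _]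
  · refine DifferentiableAt.fun_finsetProd fun j _ => ?_
    split_ifs
    exacts [hcomp (by fun_prop), differentiableAt_const _]
  · refine Finset.prod_ne_zero_iff.2 fun j _ => ?_
    split_ifs with h
    · refine barnesG_ne_zero hτ (mem_slitPlane_iff.2 (Or.inl ?_))
      have := h1 j h
      simp
      linarith
    · exact one_ne_zero
  · refine Finset.prod_ne_zero_iff.2 fun j _ => ?_
    split_ifs with h
    · refine barnesG_ne_zero hτ (mem_slitPlane_iff.2 (Or.inl ?_))
      have := h2 j h
      simp
      linarith
    · exact one_ne_zero

/-- The integral along `re s = c` does not depend on `c` within the separating strip. -/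
lemma integral_calG_vertical_eq (hτ : 0 < τ) (hm : m ≤ q) (hn : n ≤ p) {A : ℂ} (B : ℂ)
    (hcase : 0 < paramN m n p q ∨ (paramN m n p q = 0 ∧ 0 < A.re)) {c c' : ℝ}
    (hc1 : ∀ j : Fin q, m ≤ (j : ℕ) → (b j).re - τ - 1 < c)
    (hc2 : ∀ k : Fin p, n ≤ (k : ℕ) → c < (a k).re)
    (hc'1 : ∀ j : Fin q, m ≤ (j : ℕ) → (b j).re - τ - 1 < c')
    (hc'2 : ∀ k : Fin p, n ≤ (k : ℕ) → c' < (a k).re) :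
    ∫ t : ℝ, calG m n a b (c + t * I) τ *
        Complex.exp (A * (c + t * I) ^ 2 + B * (c + t * I)) =
      ∫ t : ℝ, calG m n a b (c' + t * I) τ *
        Complex.exp (A * (c' + t * I) ^ 2 + B * (c' + t * I)) := by
  wlog h : c ≤ c' generalizing c c'
  · exact (this hc'1 hc'2 hc1 hc2 (not_le.1 h).le).symm
  obtain ⟨δ, hδ, hdec⟩ := eventually_norm_integrand_le (c₁ := c) (c₂ := c') hτ hm hn a b B hcase
  refine integral_vertical_eq_of_decay_of_le
    (F := fun s => calG m n a b s τ * Complex.exp (A * s ^ 2 + B * s)) h hδ (fun s hs => ?_) hdec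
  exact (differentiableAt_calG hτ (fun j hj => (hc1 j hj).trans_le hs.1)
    fun k hk => hs.2.trans_lt (hc'2 k hk)).mul (by fun_prop)

lemma calG_add (γ s : ℂ) :
    calG m n (fun j => γ + a j) (fun j => γ + b j) s τ = calG m n a b (s - γ) τ := by
  have h1 (x : ℂ) : γ + x - s = x - (s - γ) := by ring
  have h2 (x : ℂ) : 1 + (τ : ℂ) - (γ + x) + s = 1 + τ - x + (s - γ) := by ring
  simp only [calG, h1, h2]

end Contour

end BarnesK

/-- Translation property of the `K`-function. -/
theorem Kfun_shift (τ : ℝ) (hτ : 0 < τ) (α : ℂ) (m n : ℕ) {p q : ℕ}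
    (hm : m ≤ q) (hn : n ≤ p) (a : Fin p → ℂ) (b : Fin q → ℂ)
    (hsep : ∀ j : Fin q, ∀ k : Fin p, m ≤ (j : ℕ) → n ≤ (k : ℕ) →
      (b j).re - τ - 1 < (a k).re)
    (hcase : 0 < paramN m n p q ∨ (paramN m n p q = 0 ∧ 0 < α.re))
    (γ w : ℂ) (c c' : ℝ)
    (hc1 : ∀ j : Fin q, m ≤ (j : ℕ) → (b j).re - τ - 1 < c)
    (hc2 : ∀ k : Fin p, n ≤ (k : ℕ) → c < (a k).re)
    (hc'1 : ∀ j : Fin q, m ≤ (j : ℕ) → (b j).re - τ - 1 + γ.re < c')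
    (hc'2 : ∀ k : Fin p, n ≤ (k : ℕ) → c' < (a k).re + γ.re) :
    Kfun m n (fun j => γ + a j) (fun j => γ + b j) (τ : ℂ) α c' w =
      Complex.exp ((Real.pi : ℂ) * α / (τ : ℂ) * γ ^ 2) *
        Complex.exp (-(2 * Real.pi * γ * w)) *
        Kfun m n a b (τ : ℂ) α c (w - α * γ / (τ : ℂ)) := by
  have hτ' : (τ : ℂ) ≠ 0 := by exact_mod_cast hτ.ne'
  set A : ℂ := (Real.pi : ℂ) * α / τ with hA
  set B : ℂ := -(2 * Real.pi * (w - α * γ / τ)) with hB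
  set Φ : ℂ → ℂ := fun s => calG m n a b s τ * Complex.exp (A * s ^ 2 + B * s) with hΦ
  have hAre : A.re = Real.pi * α.re / τ := by rw [hA, div_ofReal_re, re_ofReal_mul]
  have hcase' : 0 < paramN m n p q ∨ (paramN m n p q = 0 ∧ 0 < A.re) := by
    refine hcase.imp_right fun h => ⟨h.1, ?_⟩
    have := h.2
    rw [hAre]
    positivity
  have hline : ∫ t : ℝ, Φ ((c' - γ.re : ℝ) + t * I) = ∫ t : ℝ, Φ (c + t * I) :=
    BarnesK.integral_calG_vertical_eq hτ hm hn B hcase'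
      (fun j hj => by linarith [hc'1 j hj]) (fun k hk => by linarith [hc'2 k hk]) hc1 hc2
  have hright : Kfun m n a b τ α c (w - α * γ / τ) =
      1 / (2 * Real.pi * I) * ((∫ t : ℝ, Φ (c + t * I)) * I) := by
    rw [Kfun, integral_mul_const]
    congr! 4 with t
    rw [mul_assoc, ← Complex.exp_add, hΦ]
    dsimp only
    rw [hA, hB, neg_mul]
  have hleft : Kfun m n (fun j => γ + a j) (fun j => γ + b j) τ α c' w =
      1 / (2 * Real.pi * I) * (Complex.exp (A * γ ^ 2) * Complex.exp (-(2 * Real.pi * γ * w)) *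
        (∫ t : ℝ, Φ ((c' - γ.re : ℝ) + t * I)) * I) := by
    have hs := integral_sub_right_eq_self (μ := volume)
      (fun t : ℝ => Φ ((c' - γ.re : ℝ) + t * I)) γ.im
    rw [Kfun, integral_mul_const, ← hs, ← integral_const_mul]
    congr! 4 with t
    have e : ((c' - γ.re : ℝ) : ℂ) + ((t - γ.im : ℝ) : ℂ) * I = c' + t * I - γ := by
      apply Complex.ext <;> simp
    rw [e, BarnesK.calG_add, hΦ]
    dsimp only
    rw [mul_assoc, ← Complex.exp_add, ← Complex.exp_add, mul_left_comm, ← Complex.exp_add]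
    congr 2
    rw [hB, hA]
    field_simp
    ring
  rw [hleft, hright, hline]
  ring
end
end
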